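/- arXiv:1003.4721 — 2 statements merged into one kernel-verified Lean document; each statement's English description precedes it below -/
import Mathlib

section
/- Higher-order Hardy-type inequality (Lemma 3.1, smooth version on the slab). Let s ≥ 1 be an integer and let d be a real-valued function on the closed slab ℝ² × [0,1], 1-periodic in x₁ and x₂, of class C^{max(s−1,3)}, with d(x) > 0 whenever 0 < x₃ < 1, and such that d(x) = min(x₃, 1 − x₃) whenever min(x₃, 1 − x₃) ≤ 1/4. Then there exists a constant C > 0 (depending only on s and d) such that for every function u on the closed slab that is 1-periodic in x₁ and x₂, of class C^s, and vanishes on Γ = {x₃ = 0} ∪ {x₃ = 1}, one has Σ_{|α| ≤ s−1} ∫_Ω |∂^α (u/d)(x)|² dx ≤ C · Σ_{|α| ≤ s} ∫_Ω |∂^α u(x)|² dx, where α ranges over multi-indices in ℤ³₊ and ∂^α denotes the corresponding partial derivative. In other words, u/d lies in H^{s−1}(Ω) with ‖u/d‖_{H^{s−1}(Ω)} ≤ C ‖u‖_{H^s(Ω)}. -/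
open MeasureTheory Set

namespace Stmt0

/-- The closed slab `ℝ² × [0,1]`. -/
def Slab : Set (Fin 3 → ℝ) := {x | x 2 ∈ Icc (0:ℝ) 1}

/-- Fundamental domain `[0,1)² × (0,1)` of `Ω = 𝕋² × (0,1)`. -/
def Fund : Set (Fin 3 → ℝ) :=
  {x | x 0 ∈ Ico (0:ℝ) 1 ∧ x 1 ∈ Ico (0:ℝ) 1 ∧ x 2 ∈ Ioo (0:ℝ) 1}

/-- Partial derivative (within the slab) in the coordinate direction `i`. -/
noncomputable def pd (i : Fin 3) (f : (Fin 3 → ℝ) → ℝ) : (Fin 3 → ℝ) → ℝ :=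
  fun x => fderivWithin ℝ f Slab x (Pi.single i 1)

/-- Multi-index partial derivative `∂^α = ∂₀^a ∂₁^b ∂₂^c`. -/
noncomputable def mD (a b c : ℕ) (f : (Fin 3 → ℝ) → ℝ) : (Fin 3 → ℝ) → ℝ :=
  (pd 0)^[a] ((pd 1)^[b] ((pd 2)^[c] f))

/-- Squared `H^k(Ω)` Sobolev norm: the sum over multi-indices `α` with `|α| ≤ k`
of `∫_Ω |∂^α f|²`. -/
noncomputable def sob (k : ℕ) (f : (Fin 3 → ℝ) → ℝ) : ℝ :=
  ∑ a ∈ Finset.range (k+1), ∑ b ∈ Finset.range (k+1), ∑ c ∈ Finset.range (k+1),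
    if a + b + c ≤ k then ∫ x in Fund, (mD a b c f x)^2 else 0

lemma pd_eq {U : Set (Fin 3 → ℝ)} (hU : IsOpen U) (hS : U ⊆ Slab) (i : Fin 3)
    (f : (Fin 3 → ℝ) → ℝ) {x} (hx : x ∈ U) : pd i f x = fderiv ℝ f x (Pi.single i 1) := by
  unfold pd
  rw [fderivWithin_of_mem_nhds (Filter.mem_of_superset (hU.mem_nhds hx) hS)]

lemma pd_congr {U : Set (Fin 3 → ℝ)} (hU : IsOpen U) (hS : U ⊆ Slab) (i : Fin 3)
    {f g : (Fin 3 → ℝ) → ℝ} (h : EqOn f g U) : EqOn (pd i f) (pd i g) U := by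
  intro x hx
  rw [pd_eq hU hS i f hx, pd_eq hU hS i g hx]
  rw [(h.eventuallyEq_of_mem (hU.mem_nhds hx)).fderiv_eq]

lemma pdn_congr {U : Set (Fin 3 → ℝ)} (hU : IsOpen U) (hS : U ⊆ Slab) (i : Fin 3) (n : ℕ) :
    ∀ {f g : (Fin 3 → ℝ) → ℝ}, EqOn f g U → EqOn ((pd i)^[n] f) ((pd i)^[n] g) U := by
  induction n with
  | zero => intro f g h; exact h
  | succ n ih => intro f g h; exact ih (pd_congr hU hS i h)

lemma pd_cd {U : Set (Fin 3 → ℝ)} (hU : IsOpen U) (hS : U ⊆ Slab) (i : Fin 3) {n m : ℕ}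
    {f : (Fin 3 → ℝ) → ℝ} (h : ContDiffOn ℝ n f U) (hm : m + 1 ≤ n) :
    ContDiffOn ℝ m (pd i f) U := by
  have h1 : ContDiffOn ℝ m (fun x => fderiv ℝ f x (Pi.single i 1)) U :=
    (h.fderiv_of_isOpen hU (by exact_mod_cast hm)).clm_apply contDiffOn_const
  exact h1.congr fun x hx => pd_eq hU hS i f hx

lemma pdn_cd {U : Set (Fin 3 → ℝ)} (hU : IsOpen U) (hS : U ⊆ Slab) (i : Fin 3) (k : ℕ) :
    ∀ {n m : ℕ} {f : (Fin 3 → ℝ) → ℝ}, ContDiffOn ℝ n f U → m + k ≤ n →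
    ContDiffOn ℝ m ((pd i)^[k] f) U := by
  induction k with
  | zero => intro n m f h hm; exact h.of_le (by exact_mod_cast hm)
  | succ k ih =>
    intro n m f h hm
    exact ih (n := m + k) (pd_cd hU hS i h (by omega)) le_rfl

lemma mD_cd {U : Set (Fin 3 → ℝ)} (hU : IsOpen U) (hS : U ⊆ Slab) (a b c : ℕ)
    {n m : ℕ} {f : (Fin 3 → ℝ) → ℝ} (h : ContDiffOn ℝ n f U) (hm : m + a + b + c ≤ n) :
    ContDiffOn ℝ m (mD a b c f) U :=
  pdn_cd hU hS 0 a (pdn_cd hU hS 1 b (pdn_cd hU hS 2 c (m := m + a + b) h hm) le_rfl) le_rfl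

lemma slab_ud : UniqueDiffOn ℝ Slab := by
  apply uniqueDiffOn_convex
  · have : Slab = (LinearMap.proj 2 : (Fin 3 → ℝ) →ₗ[ℝ] ℝ) ⁻¹' (Icc 0 1) := rfl
    rw [this]
    exact (convex_Icc 0 1).linear_preimage _
  · refine ⟨fun _ => 1/2, ?_⟩
    have h1 : IsOpen {x : Fin 3 → ℝ | x 2 ∈ Ioo (0:ℝ) 1} :=
      isOpen_Ioo.preimage (continuous_apply 2)
    refine interior_maximal ?_ h1 ?_
    · intro x hx; exact ⟨hx.1.le, hx.2.le⟩
    · constructor <;> norm_num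

lemma pd_cdS (i : Fin 3) {n m : ℕ}
    {f : (Fin 3 → ℝ) → ℝ} (h : ContDiffOn ℝ n f Slab) (hm : m + 1 ≤ n) :
    ContDiffOn ℝ m (pd i f) Slab :=
  (h.fderivWithin slab_ud (by exact_mod_cast hm)).clm_apply contDiffOn_const

lemma pdn_cdS (i : Fin 3) (k : ℕ) :
    ∀ {n m : ℕ} {f : (Fin 3 → ℝ) → ℝ}, ContDiffOn ℝ n f Slab → m + k ≤ n →
    ContDiffOn ℝ m ((pd i)^[k] f) Slab := by
  induction k with
  | zero => intro n m f h hm; exact h.of_le (by exact_mod_cast hm)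
  | succ k ih =>
    intro n m f h hm
    exact ih (n := m + k) (pd_cdS i h (by omega)) le_rfl

lemma mD_cdS (a b c : ℕ)
    {n m : ℕ} {f : (Fin 3 → ℝ) → ℝ} (h : ContDiffOn ℝ n f Slab) (hm : m + a + b + c ≤ n) :
    ContDiffOn ℝ m (mD a b c f) Slab :=
  pdn_cdS 0 a (pdn_cdS 1 b (pdn_cdS 2 c (m := m + a + b) h hm) le_rfl) le_rfl

lemma pd_comm {U : Set (Fin 3 → ℝ)} (hU : IsOpen U) (hS : U ⊆ Slab) (i j : Fin 3)
    {f : (Fin 3 → ℝ) → ℝ} {n : ℕ} (hn : 2 ≤ n) (h : ContDiffOn ℝ n f U) :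
    EqOn (pd i (pd j f)) (pd j (pd i f)) U := by
  have key : ∀ i j : Fin 3, ∀ x ∈ U, pd i (pd j f) x =
      fderiv ℝ (fderiv ℝ f) x (Pi.single i 1) (Pi.single j 1) := by
    intro i j x hx
    have e : EqOn (pd j f) (fun x => fderiv ℝ f x (Pi.single j 1)) U :=
      fun x hx => pd_eq hU hS j f hx
    rw [pd_congr hU hS i e hx, pd_eq hU hS i _ hx]
    have hd : DifferentiableAt ℝ (fderiv ℝ f) x :=
      ((h.fderiv_of_isOpen (m := 1) hU (by exact_mod_cast hn)).contDiffAt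
        (hU.mem_nhds hx)).differentiableAt (by norm_num)
    have := (hd.hasFDerivAt.clm_apply (hasFDerivAt_const (Pi.single j (1:ℝ)) x)).fderiv
    rw [this]
    simp
  intro x hx
  rw [key i j x hx, key j i x hx]
  have := (h.contDiffAt (hU.mem_nhds hx)).isSymmSndFDerivAt (by simpa using (by exact_mod_cast hn))
  exact this _ _

lemma pd_comm_iter {U : Set (Fin 3 → ℝ)} (hU : IsOpen U) (hS : U ⊆ Slab) (i j : Fin 3) (a : ℕ) :
    ∀ {f : (Fin 3 → ℝ) → ℝ}, ContDiffOn ℝ (a + 1 : ℕ) f U →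
    EqOn (pd j ((pd i)^[a] f)) ((pd i)^[a] (pd j f)) U := by
  induction a with
  | zero => intro f h x hx; rfl
  | succ a ih =>
    intro f h
    have h1 := ih (f := pd i f) (pd_cd hU hS i h le_rfl)
    exact h1.trans (pdn_congr hU hS i a (pd_comm hU hS j i (by omega) h))

lemma pd0_mD (a b c : ℕ) (f : (Fin 3 → ℝ) → ℝ) : pd 0 (mD a b c f) = mD (a+1) b c f := by
  unfold mD; rw [Function.iterate_succ_apply']

lemma pd1_mD {U : Set (Fin 3 → ℝ)} (hU : IsOpen U) (hS : U ⊆ Slab) (a b c : ℕ)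
    {f : (Fin 3 → ℝ) → ℝ} {n : ℕ} (h : ContDiffOn ℝ n f U) (hn : a + b + c + 1 ≤ n) :
    EqOn (pd 1 (mD a b c f)) (mD a (b+1) c f) U := by
  have := pd_comm_iter hU hS 0 1 a (f := (pd 1)^[b] ((pd 2)^[c] f))
    (pdn_cd hU hS 1 b (n := a + 1 + b) (pdn_cd hU hS 2 c h (by omega)) le_rfl)
  unfold mD; rw [Function.iterate_succ_apply' (pd 1)]; exact this

lemma pd2_mD {U : Set (Fin 3 → ℝ)} (hU : IsOpen U) (hS : U ⊆ Slab) (a b c : ℕ)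
    {f : (Fin 3 → ℝ) → ℝ} {n : ℕ} (h : ContDiffOn ℝ n f U) (hn : a + b + c + 1 ≤ n) :
    EqOn (pd 2 (mD a b c f)) (mD a b (c+1) f) U := by
  have h1 := pd_comm_iter hU hS 0 2 a (f := (pd 1)^[b] ((pd 2)^[c] f))
    (pdn_cd hU hS 1 b (n := a + 1 + b) (pdn_cd hU hS 2 c h (by omega)) le_rfl)
  have h2 := pd_comm_iter hU hS 1 2 b (f := ((pd 2)^[c] f))
    (pdn_cd hU hS 2 c h (by omega))
  unfold mD; rw [Function.iterate_succ_apply' (pd 2)]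
  exact h1.trans (pdn_congr hU hS 0 a h2)

lemma pd_add {U : Set (Fin 3 → ℝ)} (hU : IsOpen U) (hS : U ⊆ Slab) (i : Fin 3)
    {f g : (Fin 3 → ℝ) → ℝ} {n : ℕ} (hn : 1 ≤ n)
    (hf : ContDiffOn ℝ n f U) (hg : ContDiffOn ℝ n g U) :
    EqOn (pd i (fun x => f x + g x)) (fun x => pd i f x + pd i g x) U := by
  intro x hx
  have hf' := (hf.contDiffAt (hU.mem_nhds hx)).differentiableAt (by exact_mod_cast (by omega : n ≠ 0))
  have hg' := (hg.contDiffAt (hU.mem_nhds hx)).differentiableAt (by exact_mod_cast (by omega : n ≠ 0))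
  simp only [pd_eq hU hS i _ hx]
  rw [fderiv_fun_add hf' hg']; rfl

lemma pd_mul {U : Set (Fin 3 → ℝ)} (hU : IsOpen U) (hS : U ⊆ Slab) (i : Fin 3)
    {f g : (Fin 3 → ℝ) → ℝ} {n : ℕ} (hn : 1 ≤ n)
    (hf : ContDiffOn ℝ n f U) (hg : ContDiffOn ℝ n g U) :
    EqOn (pd i (fun x => f x * g x)) (fun x => pd i f x * g x + f x * pd i g x) U := by
  intro x hx
  have hf' := (hf.contDiffAt (hU.mem_nhds hx)).differentiableAt (by exact_mod_cast (by omega : n ≠ 0))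
  have hg' := (hg.contDiffAt (hU.mem_nhds hx)).differentiableAt (by exact_mod_cast (by omega : n ≠ 0))
  simp only [pd_eq hU hS i _ hx]
  rw [fderiv_fun_mul hf' hg']
  simp [mul_comm]; ring

/-- recursive pointwise norm of all words of derivatives -/
noncomputable def NN : ℕ → ((Fin 3 → ℝ) → ℝ) → (Fin 3 → ℝ) → ℝ
  | 0, f, x => |f x|
  | k+1, f, x => |f x| + ∑ i : Fin 3, NN k (pd i f) x

lemma NN_nonneg (k : ℕ) : ∀ f x, 0 ≤ NN k f x := by
  induction k with
  | zero => intro f x; exact abs_nonneg _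
  | succ k ih => intro f x; exact add_nonneg (abs_nonneg _) (Finset.sum_nonneg fun i _ => ih _ _)

lemma NN_abs (k : ℕ) (f x) : |f x| ≤ NN k f x := by
  cases k with
  | zero => exact le_rfl
  | succ k => exact le_add_of_nonneg_right (Finset.sum_nonneg fun i _ => NN_nonneg _ _ _)

lemma NN_mono (k : ℕ) : ∀ f x, NN k f x ≤ NN (k+1) f x := by
  induction k with
  | zero => intro f x; exact NN_abs 1 f x
  | succ k ih => intro f x; exact add_le_add le_rfl (Finset.sum_le_sum fun i _ => ih _ _)

lemma NN_mono' {k l : ℕ} (h : k ≤ l) (f x) : NN k f x ≤ NN l f x :=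
  monotone_nat_of_le_succ (f := fun k => NN k f x) (fun k => NN_mono k f x) h

lemma NN_pd (k : ℕ) (i : Fin 3) (f x) : NN k (pd i f) x ≤ NN (k+1) f x := by
  have h1 := Finset.single_le_sum (f := fun i => NN k (pd i f) x)
    (fun i _ => NN_nonneg k (pd i f) x) (Finset.mem_univ i)
  have h2 := abs_nonneg (f x)
  simp only [NN] at *; linarith

lemma NN_pdn (k n : ℕ) (i : Fin 3) : ∀ f x, NN k ((pd i)^[n] f) x ≤ NN (k+n) f x := by
  induction n with
  | zero => intro f x; exact le_rfl
  | succ n ih => intro f x; exact (ih (pd i f) x).trans (NN_pd _ i f x)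

lemma NN_mD (a b c : ℕ) (f x) : |mD a b c f x| ≤ NN (a+b+c) f x := by
  have h1 := NN_pdn 0 a 0 ((pd 1)^[b] ((pd 2)^[c] f)) x
  have h2 := NN_pdn (0+a) b 1 ((pd 2)^[c] f) x
  have h3 := NN_pdn (0+a+b) c 2 f x
  rw [zero_add] at *
  exact h1.trans (h2.trans h3)

lemma NN_congr {U : Set (Fin 3 → ℝ)} (hU : IsOpen U) (hS : U ⊆ Slab) (k : ℕ) :
    ∀ {f g : (Fin 3 → ℝ) → ℝ}, EqOn f g U → EqOn (NN k f) (NN k g) U := by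
  induction k with
  | zero => intro f g h x hx; simp [NN, h hx]
  | succ k ih =>
    intro f g h x hx
    simp only [NN, h hx]
    congr 1
    exact Finset.sum_congr rfl fun i _ => ih (pd_congr hU hS i h) hx

lemma NN_add {U : Set (Fin 3 → ℝ)} (hU : IsOpen U) (hS : U ⊆ Slab) (k : ℕ) :
    ∀ {f g : (Fin 3 → ℝ) → ℝ}, ContDiffOn ℝ k f U → ContDiffOn ℝ k g U → ∀ x ∈ U,
    NN k (fun x => f x + g x) x ≤ NN k f x + NN k g x := by
  induction k with
  | zero => intro f g _ _ x hx; exact abs_add_le _ _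
  | succ k ih =>
    intro f g hf hg x hx
    simp only [NN]
    have h1 : ∀ i : Fin 3, NN k (pd i fun x => f x + g x) x ≤ NN k (pd i f) x + NN k (pd i g) x := by
      intro i
      rw [NN_congr hU hS k (pd_add hU hS i (by omega) hf hg) hx]
      exact ih (pd_cd hU hS i hf le_rfl) (pd_cd hU hS i hg le_rfl) x hx
    have h2 := Finset.sum_le_sum (s := Finset.univ) fun i _ => h1 i
    rw [Finset.sum_add_distrib] at h2
    have := abs_add_le (f x) (g x)
    linarith

lemma NN_mul {U : Set (Fin 3 → ℝ)} (hU : IsOpen U) (hS : U ⊆ Slab) (k : ℕ) :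
    ∀ {f g : (Fin 3 → ℝ) → ℝ}, ContDiffOn ℝ k f U → ContDiffOn ℝ k g U → ∀ x ∈ U,
    NN k (fun x => f x * g x) x ≤ 7^k * (NN k f x * NN k g x) := by
  induction k with
  | zero => intro f g _ _ x hx; simp [NN, abs_mul]
  | succ k ih =>
    intro f g hf hg x hx
    have hf0 : ContDiffOn ℝ k f U := hf.of_le (by exact_mod_cast Nat.le_succ k)
    have hg0 : ContDiffOn ℝ k g U := hg.of_le (by exact_mod_cast Nat.le_succ k)
    have h1 : ∀ i : Fin 3, NN k (pd i fun x => f x * g x) x ≤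
        2 * (7^k * (NN (k+1) f x * NN (k+1) g x)) := by
      intro i
      have hf1 := pd_cd hU hS i hf le_rfl
      have hg1 := pd_cd hU hS i hg le_rfl
      rw [NN_congr hU hS k (pd_mul hU hS i (by omega) hf hg) hx]
      refine (NN_add hU hS k (hf1.mul hg0) (hf0.mul hg1) x hx).trans ?_
      have a1 := ih hf1 hg0 x hx
      have a2 := ih hf0 hg1 x hx
      have b1 : NN k (pd i f) x * NN k g x ≤ NN (k+1) f x * NN (k+1) g x :=
        mul_le_mul (NN_pd _ _ _ _) (NN_mono _ _ _) (NN_nonneg _ _ _) (NN_nonneg _ _ _)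
      have b2 : NN k f x * NN k (pd i g) x ≤ NN (k+1) f x * NN (k+1) g x :=
        mul_le_mul (NN_mono _ _ _) (NN_pd _ _ _ _) (NN_nonneg _ _ _) (NN_nonneg _ _ _)
      have c1 := mul_le_mul_of_nonneg_left b1 (by positivity : (0:ℝ) ≤ 7^k)
      have c2 := mul_le_mul_of_nonneg_left b2 (by positivity : (0:ℝ) ≤ 7^k)
      linarith
    have h2 := Finset.sum_le_sum (s := Finset.univ) fun i _ => h1 i
    have h0 : |f x * g x| ≤ NN (k+1) f x * NN (k+1) g x := by
      rw [abs_mul]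
      exact mul_le_mul (NN_abs _ _ _) (NN_abs _ _ _) (abs_nonneg _) (NN_nonneg _ _ _)
    have h7 : (1:ℝ) ≤ 7^k := one_le_pow₀ (by norm_num)
    have hp : 0 ≤ NN (k+1) f x * NN (k+1) g x := mul_nonneg (NN_nonneg _ _ _) (NN_nonneg _ _ _)
    have e : NN (k+1) (fun x => f x * g x) x =
      |f x * g x| + ∑ i : Fin 3, NN k (pd i (fun x => f x * g x)) x := rfl
    rw [e, pow_succ]
    simp only [Finset.sum_const, Finset.card_univ, Fintype.card_fin, nsmul_eq_mul] at h2
    push_cast at h2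
    nlinarith

lemma NN_cont {U : Set (Fin 3 → ℝ)} (hU : IsOpen U) (hS : U ⊆ Slab) (k : ℕ) :
    ∀ {f : (Fin 3 → ℝ) → ℝ}, ContDiffOn ℝ k f U → ContinuousOn (NN k f) U := by
  induction k with
  | zero => intro f hf; exact hf.continuousOn.abs
  | succ k ih =>
    intro f hf
    have : NN (k+1) f = fun x => |f x| + ∑ i : Fin 3, NN k (pd i f) x := rfl
    rw [this]
    exact hf.continuousOn.abs.add (continuousOn_finsetSum _ fun i _ => ih (pd_cd hU hS i hf le_rfl))

lemma NN_le {U : Set (Fin 3 → ℝ)} (hU : IsOpen U) (hS : U ⊆ Slab) {s : ℕ}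
    {u : (Fin 3 → ℝ) → ℝ} (hu : ContDiffOn ℝ s u U) {x} (hx : x ∈ U) {R : ℝ}
    (hR : ∀ a b c, a + b + c ≤ s → |mD a b c u x| ≤ R) (m : ℕ) :
    ∀ a b c, m + a + b + c ≤ s → NN m (mD a b c u) x ≤ 4^m * R := by
  induction m with
  | zero => intro a b c h; simpa [NN] using hR a b c (by omega)
  | succ m ih =>
    intro a b c h
    have e : NN (m+1) (mD a b c u) x =
      |mD a b c u x| + ∑ i : Fin 3, NN m (pd i (mD a b c u)) x := rfl
    rw [e, Fin.sum_univ_three, pd0_mD, NN_congr hU hS m (pd1_mD hU hS a b c hu (by omega)) hx,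
      NN_congr hU hS m (pd2_mD hU hS a b c hu (by omega)) hx]
    have h0 := hR a b c (by omega)
    have h1 := ih (a+1) b c (by omega)
    have h2 := ih a (b+1) c (by omega)
    have h3 := ih a b (c+1) (by omega)
    have h4 : (1:ℝ) ≤ 4^m := one_le_pow₀ (by norm_num)
    have : 0 ≤ R := (abs_nonneg _).trans h0
    rw [pow_succ]
    nlinarith

noncomputable def PP (g : ℕ → ℝ → ℝ) : ℕ → ℝ → ℝ
  | 0, t => g 0 t
  | c+1, t => t^(c+1) * g (c+1) t - (c+1) * PP g c t

lemma PP_cont {g : ℕ → ℝ → ℝ} {T : ℝ} (c : ℕ) (hg : ∀ j ≤ c, ContinuousOn (g j) (Icc 0 T)) :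
    ContinuousOn (PP g c) (Icc 0 T) := by
  induction c with
  | zero => exact hg 0 le_rfl
  | succ c ih =>
    have e : PP g (c+1) = fun t => t^(c+1) * g (c+1) t - (c+1) * PP g c t := rfl
    rw [e]
    exact ((continuousOn_id.pow _).mul (hg _ le_rfl)).sub
      (continuousOn_const.mul (ih fun j hj => hg j (by omega)))

lemma PP_zero {g : ℕ → ℝ → ℝ} (c : ℕ) (h0 : g 0 0 = 0) : PP g c 0 = 0 := by
  induction c with
  | zero => exact h0
  | succ c ih => simp [PP, ih]

lemma PP_deriv {g : ℕ → ℝ → ℝ} {t : ℝ} (c : ℕ)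
    (hg : ∀ j ≤ c, HasDerivAt (g j) (g (j+1) t) t) :
    HasDerivAt (PP g c) (t^c * g (c+1) t) t := by
  induction c with
  | zero =>
    have e : PP g 0 = g 0 := rfl
    rw [e]; simpa using hg 0 le_rfl
  | succ c ih =>
    have e : PP g (c+1) = fun t => t^(c+1) * g (c+1) t - (c+1) * PP g c t := rfl
    rw [e]
    have h1 := (((hasDerivAt_id t).pow (c+1)).mul (hg _ le_rfl)).sub
      ((ih fun j hj => hg j (by omega)).const_mul ((c:ℝ)+1))
    refine HasDerivAt.congr_deriv (f := fun t => t^(c+1) * g (c+1) t - (c+1) * PP g c t) h1 ?_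
    simp only [id]
    push_cast
    simp
    ring

lemma PP_w {g w : ℕ → ℝ → ℝ} {t : ℝ} (c : ℕ) (hw0 : t * w 0 t = g 0 t)
    (hw : ∀ j < c, t * w (j+1) t + (j+1) * w j t = g (j+1) t) :
    PP g c t = t^(c+1) * w c t := by
  induction c with
  | zero => simp [PP, hw0]
  | succ c ih =>
    simp only [PP]
    rw [ih fun j hj => hw j (by omega), ← hw c (by omega)]
    ring

lemma hardy1 (c : ℕ) (g w : ℕ → ℝ → ℝ) {T : ℝ} (hT : 0 < T)
    (hg : ∀ j ≤ c + 1, ContinuousOn (g j) (Icc 0 T))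
    (hg' : ∀ j ≤ c, ∀ t ∈ Ioo 0 T, HasDerivAt (g j) (g (j+1) t) t)
    (h0 : g 0 0 = 0)
    (hw0 : ∀ t ∈ Ioo 0 T, t * w 0 t = g 0 t)
    (hw : ∀ t ∈ Ioo 0 T, ∀ j < c, t * w (j+1) t + (j+1) * w j t = g (j+1) t) :
    ∫⁻ t in Ioo 0 T, ENNReal.ofReal (w c t ^ 2) ≤
      4 * ∫⁻ t in Ioo 0 T, ENNReal.ofReal (g (c+1) t ^ 2) := by
  obtain ⟨M, hM⟩ := isCompact_Icc.exists_bound_of_continuousOn (hg (c+1) le_rfl)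
  have hM0 : 0 ≤ M := (norm_nonneg _).trans (hM 0 ⟨le_rfl, hT.le⟩)
  set P := PP g c with hP
  have hPc : ContinuousOn P (Icc 0 T) := PP_cont c fun j hj => hg j (by omega)
  have hPd : ∀ t ∈ Ioo 0 T, HasDerivAt P (t^c * g (c+1) t) t :=
    fun t ht => PP_deriv c fun j hj => hg' j hj t ht
  have hP0 : P 0 = 0 := PP_zero c h0
  let W : ℝ → ℝ := fun t => P t / t^(c+1)
  have hWb : ∀ t ∈ Icc 0 T, |W t| ≤ M := by
    intro t ht
    rcases ht.1.eq_or_lt with h | h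
    · simp [W, ← h, hM0]
    obtain ⟨ξ, hξ, e⟩ := exists_hasDerivAt_eq_slope P (fun t => t^c * g (c+1) t) h
      (hPc.mono (Icc_subset_Icc_right ht.2)) fun x hx => hPd x ⟨hx.1, hx.2.trans_le ht.2⟩
    have e2 : P t = t * (ξ^c * g (c+1) ξ) := by
      rw [e, hP0]; field_simp; ring
    have h1 : |P t| ≤ t * (t^c * M) := by
      rw [e2, abs_mul, abs_mul, abs_of_pos h, abs_pow, abs_of_pos hξ.1]
      have hgM := hM ξ ⟨hξ.1.le, hξ.2.le.trans ht.2⟩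
      have hp := pow_le_pow_left₀ hξ.1.le hξ.2.le c
      exact mul_le_mul_of_nonneg_left
        (mul_le_mul hp hgM (abs_nonneg _) (pow_nonneg h.le _)) h.le
    simp only [W]
    rw [abs_div, abs_of_pos (pow_pos h (c+1)), div_le_iff₀ (pow_pos h (c+1))]
    calc _ ≤ _ := h1
      _ = _ := by ring
  have hWc : ContinuousOn W (Ioc 0 T) :=
    (hPc.mono Ioc_subset_Icc_self).div (continuousOn_id.pow _)
      fun t ht => (pow_pos ht.1 _).ne'
  have hΦc : ContinuousOn (fun t => t * W t ^ 2) (Icc 0 T) := by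
    intro t ht
    rcases ht.1.eq_or_lt with h | h
    · rw [← h]
      have : Filter.Tendsto (fun t => t * W t ^ 2) (nhdsWithin 0 (Icc 0 T)) (nhds 0) := by
        refine squeeze_zero_norm' (a := fun t => t * M^2) ?_ ?_
        · filter_upwards [self_mem_nhdsWithin] with t ht
          rw [Real.norm_eq_abs, abs_mul, abs_of_nonneg ht.1, abs_pow]
          exact mul_le_mul_of_nonneg_left (pow_le_pow_left₀ (abs_nonneg _) (hWb t ht) 2) ht.1
        · have : Filter.Tendsto (fun t : ℝ => t * M^2) (nhds 0) (nhds (0 * M^2)) :=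
            (continuous_id.mul continuous_const).tendsto 0
          rw [zero_mul] at this
          exact this.mono_left nhdsWithin_le_nhds
      simpa [ContinuousWithinAt] using this
    · have h1 : ContinuousWithinAt W (Icc 0 T) t := by
        have := hWc t ⟨h, ht.2⟩
        refine this.mono_of_mem_nhdsWithin ?_
        filter_upwards [self_mem_nhdsWithin, mem_nhdsWithin_of_mem_nhds (lt_mem_nhds h)] with x h1 h2
        exact ⟨h2, h1.2⟩
      exact continuousWithinAt_id.mul (h1.pow 2)
  have hWi : IntegrableOn (fun t => W t ^ 2) (Icc 0 T) := by
    refine IntegrableOn.of_bound (by simp) ?_ (M^2) ?_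
    · rw [← Measure.restrict_congr_set Ioc_ae_eq_Icc]
      exact (hWc.pow 2).aestronglyMeasurable measurableSet_Ioc
    · filter_upwards [ae_restrict_mem measurableSet_Icc] with t ht
      rw [norm_pow]
      exact pow_le_pow_left₀ (abs_nonneg _) (hWb t ht) 2
  have hgi : IntegrableOn (fun t => g (c+1) t ^ 2) (Icc 0 T) :=
    ((hg _ le_rfl).pow 2).integrableOn_Icc
  have hsub : IntegrableOn (fun t => 2 * g (c+1) t ^ 2 - 1/2 * W t ^ 2) (Icc 0 T) :=
    Integrable.sub (f := fun t => 2 * g (c+1) t ^ 2) (g := fun t => 1/2 * W t ^ 2)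
      (hgi.const_mul 2) (hWi.const_mul (1/2))
  have key := intervalIntegral.sub_le_integral_of_hasDeriv_right_of_le
    (g := fun t => t * W t ^ 2)
    (g' := fun t => W t ^ 2 + 2 * W t * (g (c+1) t - (c+1) * W t))
    (φ := fun t => 2 * g (c+1) t ^ 2 - 1/2 * W t ^ 2) hT.le hΦc ?_
    hsub ?_
  · have hi1 : IntegrableOn (fun t => g (c+1) t ^ 2) (Ioo 0 T) := hgi.mono_set Ioo_subset_Icc_self
    have hi2 : IntegrableOn (fun t => W t ^ 2) (Ioo 0 T) := hWi.mono_set Ioo_subset_Icc_self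
    have h1 : ∫ t in Ioo 0 T, W t ^ 2 ≤ 4 * ∫ t in Ioo 0 T, g (c+1) t ^ 2 := by
      rw [intervalIntegral.integral_of_le hT.le, integral_Ioc_eq_integral_Ioo,
        integral_sub (hi1.const_mul 2) (hi2.const_mul (1/2)), integral_const_mul,
        integral_const_mul] at key
      have : 0 ≤ T * W T ^ 2 := by positivity
      linarith
    have h2 := ENNReal.ofReal_le_ofReal h1
    rw [ENNReal.ofReal_mul (by norm_num),
      ofReal_integral_eq_lintegral_ofReal hi1 (Filter.Eventually.of_forall fun _ => sq_nonneg _),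
      ofReal_integral_eq_lintegral_ofReal hi2 (Filter.Eventually.of_forall fun _ => sq_nonneg _)] at h2
    have h4 : ENNReal.ofReal 4 = 4 := by simp
    rw [h4] at h2
    refine le_trans (le_of_eq ?_) h2
    refine setLIntegral_congr_fun measurableSet_Ioo fun t ht => ?_
    have : W t = w c t := by
      simp only [W, hP]
      rw [PP_w c (hw0 t ht) (hw t ht)]
      have := (pow_pos ht.1 (c+1)).ne'
      field_simp
    simp only [this]
  · intro t ht
    have hp := (pow_pos ht.1 (c+1)).ne'
    have h1 : HasDerivAt W ((g (c+1) t - (c+1) * W t)/t) t := by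
      have := (hPd t ht).div ((hasDerivAt_id t).pow (c+1)) hp
      refine HasDerivAt.congr_deriv (f := W) this ?_
      simp only [W]
      have := ht.1.ne'
      simp
      field_simp
      ring
    have h2 := (hasDerivAt_id t).mul (h1.pow 2)
    refine HasDerivAt.hasDerivWithinAt ?_
    refine HasDerivAt.congr_deriv (f := fun t => t * W t ^ 2) h2 ?_
    have := ht.1.ne'
    simp
    field_simp
  · intro t ht
    have : (0:ℝ) ≤ c := Nat.cast_nonneg c
    nlinarith [sq_nonneg (W t - 2 * g (c+1) t), mul_nonneg this (sq_nonneg (W t))]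

lemma hardy_top (c : ℕ) (g w : ℕ → ℝ → ℝ) {T : ℝ} (hT : 0 < T)
    (hg : ∀ j ≤ c + 1, ContinuousOn (g j) (Icc (1-T) 1))
    (hg' : ∀ j ≤ c, ∀ t ∈ Ioo (1-T) 1, HasDerivAt (g j) (g (j+1) t) t)
    (h0 : g 0 1 = 0)
    (hw0 : ∀ t ∈ Ioo (1-T) 1, (1-t) * w 0 t = g 0 t)
    (hw : ∀ t ∈ Ioo (1-T) 1, ∀ j < c, (1-t) * w (j+1) t - (j+1) * w j t = g (j+1) t) :
    ∫⁻ t in Ioo (1-T) 1, ENNReal.ofReal (w c t ^ 2) ≤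
      4 * ∫⁻ t in Ioo (1-T) 1, ENNReal.ofReal (g (c+1) t ^ 2) := by
  have hmem : ∀ t ∈ Ioo 0 T, 1 - t ∈ Ioo (1-T) 1 := fun t ht =>
    ⟨by linarith [ht.2], by linarith [ht.1]⟩
  have H := hardy1 c (fun j t => (-1)^j * g j (1-t)) (fun j t => (-1)^j * w j (1-t)) hT
    (fun j hj => by
      refine continuousOn_const.mul ((hg j hj).comp (continuousOn_const.sub continuousOn_id) ?_)
      intro t ht
      exact ⟨by linarith [ht.2], by linarith [ht.1]⟩)
    (fun j hj t ht => by
      have h1 := (hg' j hj (1-t) (hmem t ht)).comp t ((hasDerivAt_id t).const_sub 1)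
      have := h1.const_mul ((-1:ℝ)^j)
      refine HasDerivAt.congr_deriv (f := fun t => (-1)^j * g j (1-t)) this ?_
      simp [pow_succ])
    (by simp [h0])
    (fun t ht => by
      have := hw0 _ (hmem t ht)
      simp only [pow_zero, one_mul]
      rw [← this]; ring)
    (fun t ht j hj => by
      have := hw _ (hmem t ht) j hj
      rw [← this, pow_succ]; ring)
  have hpre : (fun t : ℝ => 1 - t) ⁻¹' (Ioo (1-T) 1) = Ioo 0 T := by
    ext t; simp only [mem_preimage, mem_Ioo]; constructor <;> intro h <;> constructor <;> linarith [h.1, h.2]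
  have hsq : ∀ (j : ℕ) (y : ℝ), ((-1)^j * y)^2 = y^2 := by
    intro j y; rw [mul_pow, ← pow_mul, mul_comm j 2, pow_mul]; simp
  simp only [hsq] at H
  have mp : MeasurePreserving (fun t : ℝ => 1 - t) volume volume :=
    Measure.measurePreserving_sub_left volume 1
  have em : MeasurableEmbedding (fun t : ℝ => 1 - t) :=
    (MeasurableEquiv.subLeft (1:ℝ)).measurableEmbedding
  rw [← mp.setLIntegral_comp_preimage_emb em (fun t => ENNReal.ofReal (w c t ^ 2)) (Ioo (1-T) 1),
    ← mp.setLIntegral_comp_preimage_emb em (fun t => ENNReal.ofReal (g (c+1) t ^ 2)) (Ioo (1-T) 1),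
    hpre]
  exact H

lemma pd_aff {V : Set (Fin 3 → ℝ)} (hV : IsOpen V) (hS : V ⊆ Slab) (i : Fin 3) (α σ : ℝ) :
    EqOn (pd i (fun x => α + σ * x 2)) (fun _ => if i = 2 then σ else 0) V := by
  intro x hx
  rw [pd_eq hV hS i _ hx]
  have h : HasFDerivAt (fun x : Fin 3 → ℝ => α + σ * x 2)
      (σ • (ContinuousLinearMap.proj 2 : (Fin 3 → ℝ) →L[ℝ] ℝ)) x :=
    ((ContinuousLinearMap.proj (R := ℝ) (φ := fun _ : Fin 3 => ℝ) 2).hasFDerivAt.const_mul σ).const_add α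
  rw [h.fderiv]
  fin_cases i <;> simp

lemma pd_step {V : Set (Fin 3 → ℝ)} (hV : IsOpen V) (hS : V ⊆ Slab) (i : Fin 3) (α σ k : ℝ)
    {f h : (Fin 3 → ℝ) → ℝ} {n : ℕ} (hn : 1 ≤ n)
    (hf : ContDiffOn ℝ n f V) (hh : ContDiffOn ℝ n h V) :
    EqOn (pd i (fun x => (α + σ * x 2) * f x + k * h x))
      (fun x => (α + σ * x 2) * pd i f x + (if i = 2 then σ else 0) * f x + k * pd i h x) V := by
  intro x hx
  have hl : ContDiffOn ℝ n (fun x : Fin 3 → ℝ => α + σ * x 2) V := by fun_prop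
  have hk : ContDiffOn ℝ n (fun _ : Fin 3 → ℝ => k) V := contDiffOn_const
  rw [pd_add hV hS i hn (hl.mul hf) (hk.mul hh) hx]
  simp only
  have h1 := pd_mul hV hS i hn hl hf hx
  have h2 := pd_mul hV hS i hn hk hh hx
  have h3 : pd i (fun _ => k) x = 0 := by
    rw [pd_eq hV hS i _ hx]; simp
  simp only at h1 h2
  rw [h1, h2, pd_aff hV hS i α σ hx, h3]
  ring

lemma rec2 {V : Set (Fin 3 → ℝ)} (hV : IsOpen V) (hS : V ⊆ Slab) (α σ : ℝ)
    {u v : (Fin 3 → ℝ) → ℝ} (huv : EqOn u (fun x => (α + σ * x 2) * v x) V) (c : ℕ) :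
    ContDiffOn ℝ (c+1 : ℕ) v V →
    EqOn ((pd 2)^[c+1] u) (fun x => (α + σ * x 2) * (pd 2)^[c+1] v x
      + (σ * (c+1)) * (pd 2)^[c] v x) V := by
  induction c with
  | zero =>
    intro hv x hx
    have h0 : EqOn u (fun x => (α + σ * x 2) * v x + 0 * v x) V := by
      intro x hx; simpa using huv hx
    have := (pd_congr hV hS 2 h0 hx).trans (pd_step hV hS 2 α σ 0 (by omega) hv hv hx)
    simpa using this
  | succ c ih =>
    intro hv x hx
    have h0 := ih (hv.of_le (by exact_mod_cast (by omega)))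
    rw [Function.iterate_succ_apply']
    rw [pd_congr hV hS 2 h0 hx, pd_step hV hS 2 α σ _ (n := 1) le_rfl
      (pdn_cd hV hS 2 (c+1) hv (by omega)) (pdn_cd hV hS 2 c hv (by omega)) hx]
    have e1 : (pd 2)^[c+1] v = pd 2 ((pd 2)^[c] v) := Function.iterate_succ_apply' _ _ _
    have e2 : (pd 2)^[c+1+1] v = pd 2 ((pd 2)^[c+1] v) := Function.iterate_succ_apply' _ _ _
    simp only [e2, e1, if_true]
    push_cast
    ring

lemma rec01 {V : Set (Fin 3 → ℝ)} (hV : IsOpen V) (hS : V ⊆ Slab) (α σ k : ℝ) (i : Fin 3)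
    (hi : i ≠ 2) (b : ℕ) : ∀ {f h : (Fin 3 → ℝ) → ℝ},
    ContDiffOn ℝ b f V → ContDiffOn ℝ b h V →
    EqOn ((pd i)^[b] (fun x => (α + σ * x 2) * f x + k * h x))
      (fun x => (α + σ * x 2) * (pd i)^[b] f x + k * (pd i)^[b] h x) V := by
  induction b with
  | zero => intro f h _ _ x hx; rfl
  | succ b ih =>
    intro f h hf hh
    have h0 := pd_step hV hS i α σ k (by omega) hf hh
    simp only [hi, if_false, zero_mul, add_zero] at h0
    exact (pdn_congr hV hS i b h0).trans (ih (pd_cd hV hS i hf le_rfl) (pd_cd hV hS i hh le_rfl))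

lemma recD {V : Set (Fin 3 → ℝ)} (hV : IsOpen V) (hS : V ⊆ Slab) (α σ : ℝ)
    {u v : (Fin 3 → ℝ) → ℝ} (huv : EqOn u (fun x => (α + σ * x 2) * v x) V) (a b c : ℕ) {n : ℕ}
    (hv : ContDiffOn ℝ n v V) (hn : a + b + c + 1 ≤ n) :
    EqOn (mD a b (c+1) u) (fun x => (α + σ * x 2) * mD a b (c+1) v x
      + (σ * (c+1)) * mD a b c v x) V := by
  have h1 := rec2 hV hS α σ huv c (hv.of_le (by exact_mod_cast (by omega)))
  have h2 := rec01 hV hS α σ (σ * (c+1)) 1 (by decide) b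
    (pdn_cd hV hS 2 (c+1) hv (m := b) (by omega)) (pdn_cd hV hS 2 c hv (by omega))
  have h3 := rec01 hV hS α σ (σ * (c+1)) 0 (by decide) a
    (pdn_cd hV hS 1 b (n := a + b) (pdn_cd hV hS 2 (c+1) hv (m := a + b) (by omega)) le_rfl)
    (pdn_cd hV hS 1 b (n := a + b) (pdn_cd hV hS 2 c hv (m := a + b) (by omega)) le_rfl)
  exact (pdn_congr hV hS 0 a ((pdn_congr hV hS 1 b h1).trans h2)).trans h3

lemma recD0 {V : Set (Fin 3 → ℝ)} (hV : IsOpen V) (hS : V ⊆ Slab) (α σ : ℝ)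
    {u v : (Fin 3 → ℝ) → ℝ} (huv : EqOn u (fun x => (α + σ * x 2) * v x) V) (a b : ℕ) {n : ℕ}
    (hv : ContDiffOn ℝ n v V) (hn : a + b ≤ n) :
    EqOn (mD a b 0 u) (fun x => (α + σ * x 2) * mD a b 0 v x) V := by
  have h1 : EqOn u (fun x => (α + σ * x 2) * v x + 0 * v x) V := by
    intro x hx; simpa using huv hx
  have hb : ContDiffOn ℝ (b:ℕ) v V := hv.of_le (by exact_mod_cast (by omega))
  have h2 := rec01 hV hS α σ 0 1 (by decide) b hb hb
  have ha : ContDiffOn ℝ (a:ℕ) ((pd 1)^[b] v) V := pdn_cd hV hS 1 b hv hn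
  have h3 := rec01 hV hS α σ 0 0 (by decide) a ha ha
  have := (pdn_congr hV hS 0 a ((pdn_congr hV hS 1 b h1).trans h2)).trans h3
  intro x hx
  simpa [mD] using this hx

lemma pd_bdry (i : Fin 3) (hi : i ≠ 2) (r : ℝ) (hr : r ∈ Icc (0:ℝ) 1) {f : (Fin 3 → ℝ) → ℝ}
    (hf : ∀ x : Fin 3 → ℝ, x 2 = r → f x = 0) : ∀ x : Fin 3 → ℝ, x 2 = r → pd i f x = 0 := by
  intro x hx
  unfold pd
  by_cases hd : DifferentiableWithinAt ℝ f Slab x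
  · have hc : HasDerivAt (fun t : ℝ => x + t • (Pi.single i 1 : Fin 3 → ℝ)) (Pi.single i 1) 0 := by
      simpa using ((hasDerivAt_id (0:ℝ)).smul_const (Pi.single i 1 : Fin 3 → ℝ)).const_add x
    have h2 : ∀ t : ℝ, (x + t • (Pi.single i 1 : Fin 3 → ℝ)) 2 = r := by
      intro t; simp [hx, hi.symm]
    have h1 := HasFDerivWithinAt.comp_hasDerivAt_of_eq (0:ℝ) hd.hasFDerivWithinAt hc
      (Filter.Eventually.of_forall fun t => by
        show (x + t • (Pi.single i 1 : Fin 3 → ℝ)) 2 ∈ Icc (0:ℝ) 1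
        rw [h2]; exact hr) (by simp)
    have h3 : (f ∘ fun t : ℝ => x + t • (Pi.single i 1 : Fin 3 → ℝ)) = fun _ => 0 := by
      funext t; exact hf _ (h2 t)
    rw [h3] at h1
    exact h1.unique (hasDerivAt_const _ _)
  · rw [fderivWithin_zero_of_not_differentiableWithinAt hd]; rfl

lemma pdn_bdry (i : Fin 3) (hi : i ≠ 2) (r : ℝ) (hr : r ∈ Icc (0:ℝ) 1) (n : ℕ) :
    ∀ {f : (Fin 3 → ℝ) → ℝ}, (∀ x : Fin 3 → ℝ, x 2 = r → f x = 0) →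
    ∀ x : Fin 3 → ℝ, x 2 = r → (pd i)^[n] f x = 0 := by
  induction n with
  | zero => intro f hf; exact hf
  | succ n ih => intro f hf; exact ih (pd_bdry i hi r hr hf)

def FI (I : Set ℝ) : Set (Fin 3 → ℝ) :=
  {x | x 0 ∈ Ico (0:ℝ) 1 ∧ x 1 ∈ Ico (0:ℝ) 1 ∧ x 2 ∈ I}

def QQ : Set (Fin 2 → ℝ) := {y | y 0 ∈ Ico (0:ℝ) 1 ∧ y 1 ∈ Ico (0:ℝ) 1}

def ins (y : Fin 2 → ℝ) (t : ℝ) : Fin 3 → ℝ := ![y 0, y 1, t]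

lemma FI_meas {I : Set ℝ} (hI : MeasurableSet I) : MeasurableSet (FI I) :=
  (measurableSet_Ico.preimage (measurable_pi_apply 0)).inter
    ((measurableSet_Ico.preimage (measurable_pi_apply 1)).inter
      (hI.preimage (measurable_pi_apply 2)))

lemma fub {I : Set ℝ} (F : (Fin 3 → ℝ) → ENNReal)
    (hF : AEMeasurable F (volume.restrict (FI I))) :
    ∫⁻ x in FI I, F x = ∫⁻ y in QQ, ∫⁻ t in I, F (ins y t) := by
  let e := MeasurableEquiv.piFinSuccAbove (fun _ : Fin 3 => ℝ) 2
  have he : MeasurePreserving e volume volume :=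
    volume_preserving_piFinSuccAbove (fun _ : Fin 3 => ℝ) 2
  have hes : MeasurePreserving e.symm volume volume := he.symm
  have hins : ∀ p : ℝ × (Fin 2 → ℝ), e.symm p = ins p.2 p.1 := by
    intro p
    funext j
    fin_cases j <;> rfl
  have hpre : e.symm ⁻¹' (FI I) = I ×ˢ QQ := by
    ext p
    simp only [mem_preimage, hins, mem_prod]
    simp [FI, QQ, ins]
    tauto
  have hm : (volume : Measure (ℝ × (Fin 2 → ℝ))).restrict (I ×ˢ QQ)
      = (volume.restrict I).prod (volume.restrict QQ) := by
    rw [Measure.prod_restrict]; rfl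
  have h1 : MeasurePreserving e.symm (volume.restrict (I ×ˢ QQ)) (volume.restrict (FI I)) := by
    rw [← hpre]
    exact hes.restrict_preimage_emb e.symm.measurableEmbedding _
  rw [← h1.lintegral_comp_emb e.symm.measurableEmbedding, hm, lintegral_prod_symm]
  · simp only [hins]
  · rw [← hm]
    exact hF.comp_quasiMeasurePreserving h1.quasiMeasurePreserving

lemma ins_cont (y : Fin 2 → ℝ) : Continuous (ins y) := by
  refine continuous_pi fun j => ?_
  fin_cases j
  · exact continuous_const
  · exact continuous_const
  · exact continuous_id

lemma ins_deriv {V : Set (Fin 3 → ℝ)} (hV : IsOpen V) (hS : V ⊆ Slab) (y : Fin 2 → ℝ) (t : ℝ)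
    (ht : ins y t ∈ V)
    {f : (Fin 3 → ℝ) → ℝ} (hf : ContDiffOn ℝ (1:ℕ) f V) :
    HasDerivAt (fun t => f (ins y t)) (pd 2 f (ins y t)) t := by
  rw [pd_eq hV hS 2 f ht]
  have h1 : HasDerivAt (ins y) (Pi.single 2 1) t := by
    rw [hasDerivAt_pi]
    intro j
    fin_cases j
    · exact hasDerivAt_const _ _
    · exact hasDerivAt_const _ _
    · exact hasDerivAt_id t
  have hd := (hf.contDiffAt (hV.mem_nhds ht)).differentiableAt (by norm_num)
  exact hd.hasFDerivAt.comp_hasDerivAt t h1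

lemma sq_aem {V : Set (Fin 3 → ℝ)} {f : (Fin 3 → ℝ) → ℝ} (hf : ContinuousOn f V) {I : Set ℝ}
    (hI : MeasurableSet I) (hIV : FI I ⊆ V) :
    AEMeasurable (fun x => ENNReal.ofReal (f x ^ 2)) (volume.restrict (FI I)) :=
  (((hf.mono hIV).pow 2).aemeasurable (FI_meas hI)).ennreal_ofReal

lemma slab_open (p q : ℝ) : IsOpen {x : Fin 3 → ℝ | x 2 ∈ Ioo p q} :=
  isOpen_Ioo.preimage (continuous_apply 2)

lemma hardy_bot (s : ℕ) {u v : (Fin 3 → ℝ) → ℝ} (hu : ContDiffOn ℝ s u Slab)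
    (hu0 : ∀ x : Fin 3 → ℝ, x 2 = 0 → u x = 0)
    (hv : ContDiffOn ℝ s v {x | x 2 ∈ Ioo (0:ℝ) (1/4)})
    (huv : EqOn u (fun x => x 2 * v x) {x | x 2 ∈ Ioo (0:ℝ) (1/4)})
    (a b c : ℕ) (habc : a + b + c + 1 ≤ s) :
    ∫⁻ x in FI (Ioo 0 (1/4)), ENNReal.ofReal (mD a b c v x ^ 2) ≤
      4 * ∫⁻ x in FI (Ioo 0 (1/4)), ENNReal.ofReal (mD a b (c+1) u x ^ 2) := by
  have hV := slab_open 0 (1/4)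
  set V := {x : Fin 3 → ℝ | x 2 ∈ Ioo (0:ℝ) (1/4)} with hVdef
  have hS : V ⊆ Slab := fun x hx => ⟨hx.1.le, by linarith [hx.2]⟩
  have hIV : FI (Ioo 0 (1/4)) ⊆ V := fun x hx => hx.2.2
  have huv' : EqOn u (fun x => (0 + 1 * x 2) * v x) V := by intro x hx; simpa using huv hx
  rw [fub _ (sq_aem (mD_cd hV hS a b c (m := 0) hv (by omega)).continuousOn measurableSet_Ioo hIV),
    fub _ (sq_aem (mD_cdS a b (c+1) (m := 0) hu (by omega)).continuousOn measurableSet_Ioo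
      (hIV.trans hS)), ← lintegral_const_mul' _ _ (by norm_num)]
  refine lintegral_mono fun y => ?_
  refine hardy1 c (fun j t => mD a b j u (ins y t)) (fun j t => mD a b j v (ins y t))
    (by norm_num) ?_ ?_ ?_ ?_ ?_
  · intro j hj
    refine (mD_cdS a b j (m := 0) hu (by omega)).continuousOn.comp (ins_cont y).continuousOn ?_
    intro t ht
    exact ⟨ht.1, by linarith [ht.2, show ins y t 2 = t from rfl]⟩
  · intro j hj t ht
    have hx : ins y t ∈ V := ht
    have h := ins_deriv hV hS y t hx (mD_cd hV hS a b j (m := 1) (hu.mono hS) (by omega))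
    rwa [pd2_mD hV hS a b j (hu.mono hS) (by omega) hx] at h
  · exact pdn_bdry 0 (by decide) 0 (by simp) a
      (pdn_bdry 1 (by decide) 0 (by simp) b hu0) _ rfl
  · intro t ht
    have hx : ins y t ∈ V := ht
    have := recD0 hV hS 0 1 huv' a b hv (by omega) hx
    rw [this]; simp [ins]
  · intro t ht j hj
    have hx : ins y t ∈ V := ht
    have := recD hV hS 0 1 huv' a b j hv (by omega) hx
    rw [this]; simp [ins]

lemma hardy_topD (s : ℕ) {u v : (Fin 3 → ℝ) → ℝ} (hu : ContDiffOn ℝ s u Slab)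
    (hu0 : ∀ x : Fin 3 → ℝ, x 2 = 1 → u x = 0)
    (hv : ContDiffOn ℝ s v {x | x 2 ∈ Ioo (1-1/4:ℝ) 1})
    (huv : EqOn u (fun x => (1 - x 2) * v x) {x | x 2 ∈ Ioo (1-1/4:ℝ) 1})
    (a b c : ℕ) (habc : a + b + c + 1 ≤ s) :
    ∫⁻ x in FI (Ioo (1-1/4) 1), ENNReal.ofReal (mD a b c v x ^ 2) ≤
      4 * ∫⁻ x in FI (Ioo (1-1/4) 1), ENNReal.ofReal (mD a b (c+1) u x ^ 2) := by
  have hV := slab_open (1-1/4) 1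
  set V := {x : Fin 3 → ℝ | x 2 ∈ Ioo (1-1/4:ℝ) 1} with hVdef
  have hS : V ⊆ Slab := fun x hx => ⟨by linarith [hx.1], hx.2.le⟩
  have hIV : FI (Ioo (1-1/4) 1) ⊆ V := fun x hx => hx.2.2
  have huv' : EqOn u (fun x => (1 + (-1) * x 2) * v x) V := by
    intro x hx; rw [huv hx]; ring
  rw [fub _ (sq_aem (mD_cd hV hS a b c (m := 0) hv (by omega)).continuousOn measurableSet_Ioo hIV),
    fub _ (sq_aem (mD_cdS a b (c+1) (m := 0) hu (by omega)).continuousOn measurableSet_Ioo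
      (hIV.trans hS)), ← lintegral_const_mul' _ _ (by norm_num)]
  refine lintegral_mono fun y => ?_
  refine hardy_top c (fun j t => mD a b j u (ins y t)) (fun j t => mD a b j v (ins y t))
    (by norm_num) ?_ ?_ ?_ ?_ ?_
  · intro j hj
    refine (mD_cdS a b j (m := 0) hu (by omega)).continuousOn.comp (ins_cont y).continuousOn ?_
    intro t ht
    exact ⟨by linarith [ht.1, show ins y t 2 = t from rfl], ht.2⟩
  · intro j hj t ht
    have hx : ins y t ∈ V := ht
    have h := ins_deriv hV hS y t hx (mD_cd hV hS a b j (m := 1) (hu.mono hS) (by omega))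
    rwa [pd2_mD hV hS a b j (hu.mono hS) (by omega) hx] at h
  · exact pdn_bdry 0 (by decide) 1 (by simp) a
      (pdn_bdry 1 (by decide) 1 (by simp) b hu0) _ rfl
  · intro t ht
    have hx : ins y t ∈ V := ht
    have := recD0 hV hS 1 (-1) huv' a b hv (by omega) hx
    rw [this]
    show (1 - t) * _ = (1 + (-1) * t) * _
    ring
  · intro t ht j hj
    have hx : ins y t ∈ V := ht
    have := recD hV hS 1 (-1) huv' a b j hv (by omega) hx
    rw [this]; simp [ins]; ring

noncomputable def EE (s : ℕ) (u : (Fin 3 → ℝ) → ℝ) (x : Fin 3 → ℝ) : ℝ :=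
  ∑ a ∈ Finset.range (s+1), ∑ b ∈ Finset.range (s+1), ∑ c ∈ Finset.range (s+1),
    if a + b + c ≤ s then (mD a b c u x)^2 else 0

lemma EE_nonneg (s u x) : 0 ≤ EE s u x :=
  Finset.sum_nonneg fun a _ => Finset.sum_nonneg fun b _ => Finset.sum_nonneg fun c _ => by
    split_ifs
    · exact sq_nonneg _
    · exact le_rfl

lemma le_EE (s : ℕ) (u x) (a b c : ℕ) (h : a + b + c ≤ s) : (mD a b c u x)^2 ≤ EE s u x := by
  have h0 : ∀ a b c : ℕ, 0 ≤ if a + b + c ≤ s then (mD a b c u x)^2 else 0 := by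
    intro a b c; split_ifs
    · exact sq_nonneg _
    · exact le_rfl
  have h1 := Finset.single_le_sum (f := fun c => if a + b + c ≤ s then (mD a b c u x)^2 else 0)
    (fun c _ => h0 a b c) (Finset.mem_range.2 (by omega : c < s+1))
  have h2 := Finset.single_le_sum (f := fun b => ∑ c ∈ Finset.range (s+1),
      if a + b + c ≤ s then (mD a b c u x)^2 else 0)
    (fun b _ => Finset.sum_nonneg fun c _ => h0 a b c) (Finset.mem_range.2 (by omega : b < s+1))
  have h3 := Finset.single_le_sum (f := fun a => ∑ b ∈ Finset.range (s+1), ∑ c ∈ Finset.range (s+1),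
      if a + b + c ≤ s then (mD a b c u x)^2 else 0)
    (fun a _ => Finset.sum_nonneg fun b _ => Finset.sum_nonneg fun c _ => h0 a b c)
    (Finset.mem_range.2 (by omega : a < s+1))
  simp only [h, if_true] at h1
  exact h1.trans (h2.trans h3)

lemma fund_sub : Fund ⊆ Icc (0 : Fin 3 → ℝ) 1 := by
  intro x hx
  obtain ⟨h0, h1, h2⟩ := hx
  constructor
  · intro i; fin_cases i
    · exact h0.1
    · exact h1.1
    · exact h2.1.le
  · intro i; fin_cases i
    · exact h0.2.le
    · exact h1.2.le
    · exact h2.2.le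

lemma mD_int (s : ℕ) {u : (Fin 3 → ℝ) → ℝ} (hu : ContDiffOn ℝ s u Slab) (a b c : ℕ)
    (h : a + b + c ≤ s) : IntegrableOn (fun x => (mD a b c u x)^2) Fund := by
  have hc := (mD_cdS a b c (m := 0) hu (by omega)).continuousOn.pow 2
  have hs : Icc (0 : Fin 3 → ℝ) 1 ⊆ Slab := fun x hx => ⟨hx.1 2, hx.2 2⟩
  exact ((hc.mono hs).integrableOn_compact isCompact_Icc).mono_set fund_sub

lemma EE_int (s : ℕ) {u : (Fin 3 → ℝ) → ℝ} (hu : ContDiffOn ℝ s u Slab) :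
    IntegrableOn (EE s u) Fund ∧ ∫ x in Fund, EE s u x = sob s u := by
  have h0 : ∀ a b c : ℕ, Integrable (fun x => if a + b + c ≤ s then (mD a b c u x)^2 else 0)
      (volume.restrict Fund) := by
    intro a b c; split_ifs with h
    · exact mD_int s hu a b c h
    · exact integrable_zero _ _ _
  have h1 : ∀ a b : ℕ, Integrable (fun x => ∑ c ∈ Finset.range (s+1),
      if a + b + c ≤ s then (mD a b c u x)^2 else 0) (volume.restrict Fund) :=
    fun a b => integrable_finsetSum _ fun c _ => h0 a b c
  have h2 : ∀ a : ℕ, Integrable (fun x => ∑ b ∈ Finset.range (s+1), ∑ c ∈ Finset.range (s+1),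
      if a + b + c ≤ s then (mD a b c u x)^2 else 0) (volume.restrict Fund) :=
    fun a => integrable_finsetSum _ fun b _ => h1 a b
  refine ⟨integrable_finsetSum _ fun a _ => h2 a, ?_⟩
  unfold EE sob
  rw [integral_finsetSum _ fun a _ => h2 a]
  refine Finset.sum_congr rfl fun a _ => ?_
  rw [integral_finsetSum _ fun b _ => h1 a b]
  refine Finset.sum_congr rfl fun b _ => ?_
  rw [integral_finsetSum _ fun c _ => h0 a b c]
  refine Finset.sum_congr rfl fun c _ => ?_
  split_ifs <;> simp

/-- Higher-order Hardy-type inequality (Lemma 3.1, smooth version on the slab). -/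
theorem higher_order_hardy (s : ℕ) (hs : 1 ≤ s) (d : (Fin 3 → ℝ) → ℝ)
    (hd_smooth : ContDiffOn ℝ (max (s-1) 3 : ℕ) d Slab)
    (hd_per0 : ∀ x, d (x + Pi.single 0 1) = d x)
    (hd_per1 : ∀ x, d (x + Pi.single 1 1) = d x)
    (hd_pos : ∀ x : Fin 3 → ℝ, 0 < x 2 → x 2 < 1 → 0 < d x)
    (hd_dist : ∀ x : Fin 3 → ℝ, x 2 ∈ Icc (0:ℝ) 1 →
      min (x 2) (1 - x 2) ≤ 1/4 → d x = min (x 2) (1 - x 2)) :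
    ∃ C > 0, ∀ u : (Fin 3 → ℝ) → ℝ,
      ContDiffOn ℝ (s : ℕ∞) u Slab →
      (∀ x, u (x + Pi.single 0 1) = u x) →
      (∀ x, u (x + Pi.single 1 1) = u x) →
      (∀ x : Fin 3 → ℝ, x 2 = 0 ∨ x 2 = 1 → u x = 0) →
      sob (s-1) (fun x => u x / d x) ≤ C * sob s u := by
  have hU := slab_open 0 1
  set U := {x : Fin 3 → ℝ | x 2 ∈ Ioo (0:ℝ) 1} with hUdef
  have hS : U ⊆ Slab := fun x hx => ⟨hx.1.le, hx.2.le⟩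
  have hdU : ContDiffOn ℝ (s-1 : ℕ) d U :=
    (hd_smooth.mono hS).of_le (by exact_mod_cast le_max_left _ _)
  have hinv : ContDiffOn ℝ (s-1 : ℕ) (fun x => (d x)⁻¹) U :=
    hdU.inv fun x hx => (hd_pos x hx.1 hx.2).ne'
  obtain ⟨M, hM⟩ := (isCompact_Icc (a := (![0,0,1/4] : Fin 3 → ℝ)) (b := ![1,1,3/4])).exists_bound_of_continuousOn
    ((NN_cont hU hS (s-1) hinv).mono (by
      intro x hx
      have h1 := hx.1 2
      have h2 := hx.2 2
      simp at h1 h2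
      exact ⟨by linarith, by linarith⟩))
  set A : ℝ := 7^(s-1) * 4^(s-1) * M with hA
  refine ⟨((s:ℝ)-1+1)^3 * (8 + A^2), by
    have : (0:ℝ) < s := by exact_mod_cast hs
    have h2 : (s:ℝ) - 1 + 1 = s := by ring
    rw [h2]; positivity, ?_⟩
  intro u hu _ _ hu0
  replace hu : ContDiffOn ℝ s u Slab := by exact_mod_cast hu
  obtain ⟨hEi, hE⟩ := EE_int s hu
  have hEl : ∫⁻ x in Fund, ENNReal.ofReal (EE s u x) = ENNReal.ofReal (sob s u) := by
    rw [← hE, ofReal_integral_eq_lintegral_ofReal hEi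
      (Filter.Eventually.of_forall fun x => EE_nonneg s u x)]
  have hsob0 : 0 ≤ sob s u := by
    rw [← hE]; exact integral_nonneg fun x => EE_nonneg s u x
  set v : (Fin 3 → ℝ) → ℝ := fun x => u x / d x with hvdef
  have hvmul : v = fun x => u x * (d x)⁻¹ := by funext x; exact div_eq_mul_inv _ _
  have huU : ContDiffOn ℝ (s-1 : ℕ) u U := (hu.mono hS).of_le (by exact_mod_cast Nat.sub_le s 1)
  have hvU : ContDiffOn ℝ (s-1 : ℕ) v U := by
    rw [hvmul]; exact huU.mul hinv
  -- bottom
  have dbot : ∀ x : Fin 3 → ℝ, x 2 ∈ Ioo (0:ℝ) (1/4) → d x = x 2 := by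
    intro x hx
    have h : min (x 2) (1 - x 2) = x 2 := min_eq_left (by linarith [hx.2])
    rw [hd_dist x ⟨hx.1.le, by linarith [hx.2]⟩ (by rw [h]; exact hx.2.le), h]
  have dtop : ∀ x : Fin 3 → ℝ, x 2 ∈ Ioo (1-1/4:ℝ) 1 → d x = 1 - x 2 := by
    intro x hx
    have h : min (x 2) (1 - x 2) = 1 - x 2 := min_eq_right (by linarith [hx.1])
    rw [hd_dist x ⟨by linarith [hx.1], hx.2.le⟩ (by rw [h]; linarith [hx.1]), h]
  have hvbot : ContDiffOn ℝ s v {x | x 2 ∈ Ioo (0:ℝ) (1/4)} := by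
    have h1 : ContDiffOn ℝ s (fun x => u x / x 2) {x : Fin 3 → ℝ | x 2 ∈ Ioo (0:ℝ) (1/4)} :=
      (hu.mono fun x hx => ⟨hx.1.le, by linarith [hx.2]⟩).div (by fun_prop) fun x hx => hx.1.ne'
    exact h1.congr fun x hx => by simp only [hvdef, dbot x hx]
  have hvtop : ContDiffOn ℝ s v {x | x 2 ∈ Ioo (1-1/4:ℝ) 1} := by
    have h1 : ContDiffOn ℝ s (fun x => u x / (1 - x 2)) {x : Fin 3 → ℝ | x 2 ∈ Ioo (1-1/4:ℝ) 1} :=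
      (hu.mono fun x hx => ⟨by linarith [hx.1], hx.2.le⟩).div (by fun_prop)
        fun x hx => (by linarith [hx.2] : 0 < 1 - x 2).ne'
    exact h1.congr fun x hx => by simp only [hvdef, dtop x hx]
  have huvbot : EqOn u (fun x => x 2 * v x) {x | x 2 ∈ Ioo (0:ℝ) (1/4)} := by
    intro x hx
    have := hx.1.ne'
    simp only [hvdef, dbot x hx]
    field_simp
  have huvtop : EqOn u (fun x => (1 - x 2) * v x) {x | x 2 ∈ Ioo (1-1/4:ℝ) 1} := by
    intro x hx
    have := (by linarith [hx.2] : 0 < 1 - x 2).ne'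
    simp only [hvdef, dtop x hx]
    field_simp
  have main : ∀ a b c : ℕ, a + b + c ≤ s - 1 →
      ∫ x in Fund, (mD a b c v x)^2 ≤ (8 + A^2) * sob s u := by
    intro a b c habc
    have hcont : ContinuousOn (mD a b c v) U := (mD_cd hU hS a b c (m := 0) hvU (by omega)).continuousOn
    have hFm : MeasurableSet Fund := FI_meas (I := Ioo 0 1) measurableSet_Ioo
    have hFU : Fund ⊆ U := fun x hx => hx.2.2
    rw [integral_eq_lintegral_of_nonneg_ae (Filter.Eventually.of_forall fun x => sq_nonneg _)
      (((hcont.mono hFU).pow 2).aestronglyMeasurable hFm)]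
    refine ENNReal.toReal_le_of_le_ofReal (by positivity) ?_
    have hbE : ∀ I ⊆ Ioo (0:ℝ) 1, ∫⁻ x in FI I, ENNReal.ofReal (mD a b (c+1) u x ^ 2) ≤
        ENNReal.ofReal (sob s u) := by
      intro I hI
      rw [← hEl]
      refine (lintegral_mono_set (t := Fund) fun x hx => ⟨hx.1, hx.2.1, hI hx.2.2⟩).trans ?_
      exact lintegral_mono fun x => ENNReal.ofReal_le_ofReal (le_EE s u x a b (c+1) (by omega))
    have hB := (hardy_bot s hu (fun x hx => hu0 x (Or.inl hx)) hvbot huvbot a b c (by omega)).trans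
      (mul_le_mul_right (hbE (Ioo 0 (1/4)) (Ioo_subset_Ioo_right (by norm_num))) 4)
    have hTp := (hardy_topD s hu (fun x hx => hu0 x (Or.inr hx)) hvtop huvtop a b c (by omega)).trans
      (mul_le_mul_right (hbE (Ioo (1-1/4) 1) (Ioo_subset_Ioo_left (by norm_num))) 4)
    have hMid : ∫⁻ x in FI (Icc (1/4) (1-1/4)), ENNReal.ofReal (mD a b c v x ^ 2) ≤
        ENNReal.ofReal (A^2 * sob s u) := by
      have hpt : ∀ x ∈ FI (Icc (1/4) (1-1/4)), mD a b c v x ^ 2 ≤ A^2 * EE s u x := by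
        intro x hx
        obtain ⟨h0, h1, h2⟩ := hx
        have hxU : x ∈ U := ⟨by linarith [h2.1], by linarith [h2.2]⟩
        have hxK : x ∈ Icc (![0,0,1/4] : Fin 3 → ℝ) ![1,1,3/4] := by
          constructor
          · intro i; fin_cases i
            · exact h0.1
            · exact h1.1
            · exact h2.1
          · intro i; fin_cases i
            · exact h0.2.le
            · exact h1.2.le
            · show x 2 ≤ 3/4
              linarith [h2.2]
        have b1 := NN_mD a b c v x
        have b2 := NN_mono' habc v x
        have b3 : NN (s-1) v x ≤ 7^(s-1) * (NN (s-1) u x * NN (s-1) (fun x => (d x)⁻¹) x) := by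
          rw [hvmul]; exact NN_mul hU hS (s-1) huU hinv x hxU
        have b4 := (le_abs_self _).trans (hM x hxK)
        have b5 := NN_le hU hS (hu.mono hS) hxU (R := Real.sqrt (EE s u x))
          (fun a b c h => Real.abs_le_sqrt (le_EE s u x a b c h)) (s-1) 0 0 0 (by omega)
        have b5' : NN (s-1) u x ≤ 4^(s-1) * Real.sqrt (EE s u x) := b5
        have b6 := mul_le_mul b5' b4 (NN_nonneg _ _ _) (by positivity)
        have b7 := mul_le_mul_of_nonneg_left b6 (by positivity : (0:ℝ) ≤ 7^(s-1))
        have b8 : |mD a b c v x| ≤ A * Real.sqrt (EE s u x) := by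
          refine (b1.trans (b2.trans (b3.trans b7))).trans (le_of_eq ?_)
          rw [hA]; ring
        have b9 := pow_le_pow_left₀ (abs_nonneg _) b8 2
        rwa [sq_abs, mul_pow, Real.sq_sqrt (EE_nonneg s u x)] at b9
      calc _ ≤ ∫⁻ x in FI (Icc (1/4) (1-1/4)), ENNReal.ofReal (A^2) * ENNReal.ofReal (EE s u x) := by
            refine setLIntegral_mono' (FI_meas measurableSet_Icc) fun x hx => ?_
            rw [← ENNReal.ofReal_mul (sq_nonneg _)]
            exact ENNReal.ofReal_le_ofReal (hpt x hx)
        _ ≤ ∫⁻ x in Fund, ENNReal.ofReal (A^2) * ENNReal.ofReal (EE s u x) :=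
            lintegral_mono_set fun x hx =>
              ⟨hx.1, hx.2.1, by linarith [hx.2.2.1], by linarith [hx.2.2.2]⟩
        _ = _ := by
            rw [lintegral_const_mul' _ _ ENNReal.ofReal_ne_top, hEl, ENNReal.ofReal_mul (sq_nonneg _)]
    have hsub : Fund ⊆ (FI (Ioo 0 (1/4)) ∪ FI (Ioo (1-1/4) 1)) ∪ FI (Icc (1/4) (1-1/4)) := by
      intro x hx
      obtain ⟨h0, h1, h2⟩ := hx
      rcases lt_or_ge (x 2) (1/4) with h | h
      · exact Or.inl (Or.inl ⟨h0, h1, h2.1, h⟩)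
      · rcases lt_or_ge (1-1/4) (x 2) with h' | h'
        · exact Or.inl (Or.inr ⟨h0, h1, h', h2.2⟩)
        · exact Or.inr ⟨h0, h1, h, h'⟩
    calc _ ≤ _ := lintegral_mono_set hsub
      _ ≤ _ := lintegral_union_le _ _ _
      _ ≤ _ := add_le_add (lintegral_union_le _ _ _) le_rfl
      _ ≤ (4 * ENNReal.ofReal (sob s u) + 4 * ENNReal.ofReal (sob s u)) +
          ENNReal.ofReal (A^2 * sob s u) := add_le_add (add_le_add hB hTp) hMid
      _ = _ := by
          have h4 : (4:ENNReal) = ENNReal.ofReal 4 := by simp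
          rw [h4, ← ENNReal.ofReal_mul (by norm_num), ← ENNReal.ofReal_add (by positivity) (by positivity),
            ← ENNReal.ofReal_add (by positivity) (by positivity)]
          congr 1; ring
  have hX : 0 ≤ (8 + A^2) * sob s u := by positivity
  calc sob (s-1) v ≤ ∑ a ∈ Finset.range (s-1+1), ∑ b ∈ Finset.range (s-1+1),
        ∑ c ∈ Finset.range (s-1+1), (8 + A^2) * sob s u := by
        unfold sob
        refine Finset.sum_le_sum fun a _ => Finset.sum_le_sum fun b _ => Finset.sum_le_sum fun c _ => ?_
        split_ifs with h
        · exact main a b c h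
        · exact hX
    _ = _ := by
        simp only [Finset.sum_const, Finset.card_range, nsmul_eq_mul]
        push_cast [Nat.cast_sub hs]
        ring

end Stmt0
end

section
/- One-dimensional higher-order Hardy-type inequality. For every integer s ≥ 1 there exists a constant C > 0 such that for every function u : [0,1] → ℝ of class C^s with u(0) = u(1) = 0, setting d(x) = x(1 − x), one has Σ_{i=0}^{s−1} ∫₀¹ |(u/d)^{(i)}(x)|² dx ≤ C · Σ_{i=0}^{s} ∫₀¹ |u^{(i)}(x)|² dx, where g^{(i)} denotes the i-th derivative of g on (0,1). -/
open MeasureTheory Set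

open Filter Topology in
theorem hardy_aux (n : ℕ) (w w' g : ℝ → ℝ) (M : ℝ)
    (hw : ∀ x ∈ Ioo (0:ℝ) 1, HasDerivAt w (w' x) x)
    (hg : ∀ x ∈ Ioo (0:ℝ) 1, g x = x * w' x + (n + 1) * w x)
    (hgc : ContinuousOn g (Ioo 0 1)) (hM : ∀ x ∈ Ioo (0:ℝ) 1, |g x| ≤ M)
    (h0 : Tendsto (fun x => x ^ (n + 1) * w x) (𝓝[>] 0) (𝓝 0)) :
    IntegrableOn (fun x => w x ^ 2) (Ioo 0 1) ∧ IntegrableOn (fun x => g x ^ 2) (Ioo 0 1) ∧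
    ∫ x in Ioo (0:ℝ) 1, w x ^ 2 ≤ 4 * ∫ x in Ioo (0:ℝ) 1, g x ^ 2 := by
  have hM0 : 0 ≤ M := (abs_nonneg _).trans (hM (1/2) (by constructor <;> norm_num))
  -- derivative of `x^(n+1) w`
  have hW : ∀ x ∈ Ioo (0:ℝ) 1, HasDerivAt (fun x => x ^ (n + 1) * w x) (x ^ n * g x) x := by
    intro x hx
    have := (hasDerivAt_pow (n + 1) x).mul (hw x hx)
    refine this.congr_deriv ?_
    rw [hg x hx]; push_cast; ring
  have hWc : ContinuousOn (fun x => x ^ (n + 1) * w x) (Ico 0 1) := by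
    intro x hx
    rcases hx.1.eq_or_lt with h | h
    · subst h
      have h1 : ContinuousWithinAt (fun x => x ^ (n + 1) * w x) (Ioi 0) 0 := by
        simpa [ContinuousWithinAt] using h0
      exact (continuousWithinAt_Ioi_iff_Ici.1 h1).mono Ico_subset_Ici_self
    · exact (hW x ⟨h, hx.2⟩).continuousAt.continuousWithinAt
  have key : ∀ c : ℝ, |c| ≤ 1 → ∀ x ∈ Ioo (0:ℝ) 1, 0 ≤ M * x ^ (n + 1) + c * (x ^ (n + 1) * w x) := by
    intro c hc x hx
    have hd : ∀ y ∈ Ioo (0:ℝ) 1, HasDerivAt (fun x => M * x ^ (n + 1) + c * (x ^ (n + 1) * w x))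
        (M * ((n + 1) * y ^ n) + c * (y ^ n * g y)) y := by
      intro y hy
      have h1 := ((hasDerivAt_pow (n + 1) y).const_mul M).add ((hW y hy).const_mul c)
      refine h1.congr_deriv ?_
      push_cast; simp
    have hm : MonotoneOn (fun x => M * x ^ (n + 1) + c * (x ^ (n + 1) * w x)) (Ico 0 1) := by
      apply monotoneOn_of_deriv_nonneg (convex_Ico 0 1)
      · exact (by fun_prop : ContinuousOn (fun x : ℝ => M * x ^ (n + 1)) (Ico 0 1)).add
          (continuousOn_const.mul hWc)
      · rw [interior_Ico]
        exact fun y hy => (hd y hy).differentiableAt.differentiableWithinAt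
      · rw [interior_Ico]
        intro y hy
        rw [(hd y hy).deriv]
        have h1 : |c * g y| ≤ M := by
          rw [abs_mul]
          calc |c| * |g y| ≤ 1 * M := mul_le_mul hc (hM y hy) (abs_nonneg _) zero_le_one
            _ = M := one_mul _
        have h2 := (abs_le.1 h1).1
        have h3 : 0 ≤ y ^ n := pow_nonneg hy.1.le _
        have h4 : 0 ≤ (n : ℝ) * M := by positivity
        have : M * ((n + 1) * y ^ n) + c * (y ^ n * g y) = y ^ n * (n * M + M + c * g y) := by ring
        rw [this]
        exact mul_nonneg h3 (by linarith)
    have := hm (by simp : (0:ℝ) ∈ Ico (0:ℝ) 1) ⟨hx.1.le, hx.2⟩ hx.1.le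
    simpa using this
  have hwM : ∀ x ∈ Ioo (0:ℝ) 1, |w x| ≤ M := by
    intro x hx
    have hp : 0 < x ^ (n + 1) := pow_pos hx.1 _
    have h1 := key 1 (by simp) x hx
    have h2 := key (-1) (by simp) x hx
    rw [abs_le]
    constructor
    · by_contra h
      push Not at h
      nlinarith
    · by_contra h
      push Not at h
      nlinarith
  have hwc : ContinuousOn w (Ioo 0 1) := fun x hx => (hw x hx).continuousAt.continuousWithinAt
  have hint : ∀ f : ℝ → ℝ, ContinuousOn f (Ioo 0 1) → (∀ x ∈ Ioo (0:ℝ) 1, |f x| ≤ M) →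
      IntegrableOn (fun x => f x ^ 2) (Ioo 0 1) := by
    intro f hf hfM
    refine IntegrableOn.of_bound (by simp) ((hf.pow 2).aestronglyMeasurable measurableSet_Ioo) (M ^ 2) ?_
    refine (ae_restrict_iff' measurableSet_Ioo).2 (Eventually.of_forall fun x hx => ?_)
    rw [Real.norm_eq_abs, abs_pow]
    exact pow_le_pow_left₀ (abs_nonneg _) (hfM x hx) 2
  have iw := hint w hwc hwM
  have ig := hint g hgc hM
  refine ⟨iw, ig, ?_⟩
  have iφ : IntegrableOn (fun x => 2 * g x ^ 2 - 1 / 2 * w x ^ 2) (Ioo 0 1) :=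
    (ig.const_mul 2).sub (iw.const_mul (1/2))
  have iφ' : IntegrableOn (fun x => 2 * g x ^ 2 - 1 / 2 * w x ^ 2) (Icc 0 1) :=
    (integrableOn_Icc_iff_integrableOn_Ioo).2 iφ
  have hE : ∀ b ∈ Ioo (0:ℝ) 1, 0 ≤ ∫ x in (0:ℝ)..b, (2 * g x ^ 2 - 1 / 2 * w x ^ 2) := by
    intro b hb
    have h1 := intervalIntegral.sub_le_integral_of_hasDeriv_right_of_le (a := 0) (b := b)
      (g := fun x => x * w x ^ 2) (g' := fun x => w x ^ 2 + x * (2 * w x * w' x))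
      (φ := fun x => 2 * g x ^ 2 - 1 / 2 * w x ^ 2) hb.1.le ?_ ?_ ?_ ?_
    · have : 0 ≤ b * w b ^ 2 := mul_nonneg hb.1.le (sq_nonneg _)
      simp only [zero_mul, sub_zero] at h1
      linarith
    · intro x hx
      rcases hx.1.eq_or_lt with h | h
      · subst h
        have h1 : ContinuousWithinAt (fun x => x * w x ^ 2) (Ioi 0) 0 := by
          unfold ContinuousWithinAt
          simp only [zero_mul]
          have hu : Tendsto (fun x : ℝ => x * M ^ 2) (𝓝[>] 0) (𝓝 0) := by
            have : Tendsto (fun x : ℝ => x * M ^ 2) (𝓝 0) (𝓝 (0 * M ^ 2)) :=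
              (continuous_id.mul continuous_const).tendsto 0
            rw [zero_mul] at this
            exact this.mono_left nhdsWithin_le_nhds
          have hev : ∀ᶠ x in 𝓝[>] (0:ℝ), x ∈ Ioo (0:ℝ) 1 := Ioo_mem_nhdsGT zero_lt_one
          refine tendsto_of_tendsto_of_tendsto_of_le_of_le' tendsto_const_nhds hu ?_ ?_
          · filter_upwards [hev] with x hx
            exact mul_nonneg hx.1.le (sq_nonneg _)
          · filter_upwards [hev] with x hx
            refine mul_le_mul_of_nonneg_left ?_ hx.1.le
            rw [← sq_abs]
            exact pow_le_pow_left₀ (abs_nonneg _) (hwM x hx) 2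
        exact (continuousWithinAt_Ioi_iff_Ici.1 h1).mono Icc_subset_Ici_self
      · have := (hw x ⟨h, hx.2.trans_lt hb.2⟩).continuousAt
        exact (continuousAt_id.mul (this.pow 2)).continuousWithinAt
    · intro x hx
      have := (hasDerivAt_id x).mul ((hw x ⟨hx.1, hx.2.trans hb.2⟩).pow 2)
      refine (this.congr_deriv ?_).hasDerivWithinAt
      simp
    · exact iφ'.mono_set (Icc_subset_Icc_right hb.2.le)
    · intro x hx
      have h2 := hg x ⟨hx.1, hx.2.trans hb.2⟩
      have h3 : x * w' x = g x - (n + 1) * w x := by linarith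
      have h4 : w x ^ 2 + x * (2 * w x * w' x) = w x ^ 2 + 2 * w x * (g x - (n + 1) * w x) := by
        rw [← h3]; ring
      rw [h4]
      have h5 : 0 ≤ (n : ℝ) * w x ^ 2 := by positivity
      nlinarith [sq_nonneg (2 * g x - w x)]
  have hlim : 0 ≤ ∫ x in (0:ℝ)..1, (2 * g x ^ 2 - 1 / 2 * w x ^ 2) := by
    have hc := intervalIntegral.continuousOn_primitive_interval (a := 0) (b := 1) (μ := volume)
      (f := fun x => 2 * g x ^ 2 - 1 / 2 * w x ^ 2) (by rwa [uIcc_of_le zero_le_one])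
    rw [uIcc_of_le zero_le_one] at hc
    have h1 := (hc 1 (by simp)).mono Ioo_subset_Icc_self
    have : (𝓝[Ioo (0:ℝ) 1] 1).NeBot := right_nhdsWithin_Ioo_neBot zero_lt_one
    exact ge_of_tendsto h1 (eventually_nhdsWithin_of_forall hE)
  rw [intervalIntegral.integral_of_le zero_le_one, integral_Ioc_eq_integral_Ioo,
    integral_sub (ig.const_mul 2) (iw.const_mul (1/2)), integral_const_mul, integral_const_mul] at hlim
  linarith

theorem hasDerivAt_iter {f : ℝ → ℝ} {x : ℝ} {n s : ℕ} (hf : ContDiffAt ℝ s f x) (h : n < s) :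
    HasDerivAt (iteratedDeriv n f) (iteratedDeriv (n + 1) f x) x := by
  have h1 := ContDiffWithinAt.differentiableWithinAt_iteratedDerivWithin (s := univ) (m := n)
    hf.contDiffWithinAt (by exact_mod_cast h) (by simpa using uniqueDiffOn_univ)
  rw [iteratedDerivWithin_univ, differentiableWithinAt_univ] at h1
  rw [iteratedDeriv_succ]
  exact h1.hasDerivAt

open Filter Topology in
theorem hardy_left (s : ℕ) (u : ℝ → ℝ) (hu : ContDiffOn ℝ s u (Icc (0:ℝ) 1)) (h0 : u 0 = 0)
    (i : ℕ) (hi : i < s) :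
    IntegrableOn (fun x => iteratedDeriv i (fun y => u y / y) x ^ 2) (Ioo 0 1) ∧
    IntegrableOn (fun x => iteratedDeriv (i + 1) u x ^ 2) (Ioo 0 1) ∧
    ∫ x in Ioo (0:ℝ) 1, iteratedDeriv i (fun y => u y / y) x ^ 2
      ≤ 4 * ∫ x in Ioo (0:ℝ) 1, iteratedDeriv (i + 1) u x ^ 2 := by
  set v : ℝ → ℝ := fun y => u y / y with hv
  have hua : ∀ x ∈ Ioo (0:ℝ) 1, ContDiffAt ℝ s u x := fun x hx =>
    hu.contDiffAt (Icc_mem_nhds hx.1 hx.2)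
  have hva : ∀ x ∈ Ioo (0:ℝ) 1, ContDiffAt ℝ s v x := fun x hx =>
    (hua x hx).div contDiffAt_id hx.1.ne'
  have hun : UniqueDiffOn ℝ (Icc (0:ℝ) 1) := uniqueDiffOn_Icc zero_lt_one
  have huc : ∀ n ≤ s, ContinuousOn (iteratedDerivWithin n u (Icc 0 1)) (Icc 0 1) := fun n hn =>
    hu.continuousOn_iteratedDerivWithin (by exact_mod_cast hn) hun
  have hueq : ∀ n ≤ s, ∀ x ∈ Ioo (0:ℝ) 1, iteratedDerivWithin n u (Icc 0 1) x = iteratedDeriv n u x :=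
    fun n hn x hx => iteratedDerivWithin_eq_iteratedDeriv hun
      ((hua x hx).of_le (by exact_mod_cast hn)) (Ioo_subset_Icc_self hx)
  have hrec : ∀ n < s, ∀ x ∈ Ioo (0:ℝ) 1,
      iteratedDeriv (n + 1) u x = x * iteratedDeriv (n + 1) v x + (n + 1) * iteratedDeriv n v x := by
    intro n
    induction n with
    | zero =>
      intro hn x hx
      have h1 := (hasDerivAt_id x).mul (hasDerivAt_iter (hva x hx) hn)
      have h2 : u =ᶠ[𝓝 x] (id * iteratedDeriv 0 v) := by
        filter_upwards [Ioo_mem_nhds hx.1 hx.2] with y hy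
        have := hy.1.ne'
        simp [hv]; field_simp
      have h3 := (h1.congr_of_eventuallyEq h2).deriv
      rw [iteratedDeriv_succ, iteratedDeriv_zero, h3]
      simp; ring
    | succ n ih =>
      intro hn x hx
      have h1 := ((hasDerivAt_id x).mul (hasDerivAt_iter (hva x hx) hn)).add
        ((hasDerivAt_iter (hva x hx) (Nat.lt_of_succ_lt hn)).const_mul ((n:ℝ) + 1))
      have h2 : iteratedDeriv (n + 1) u =ᶠ[𝓝 x] (id * iteratedDeriv (n + 1) v +
          fun y => ((n:ℝ) + 1) * iteratedDeriv n v y) := by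
        filter_upwards [Ioo_mem_nhds hx.1 hx.2] with y hy
        rw [ih (Nat.lt_of_succ_lt hn) y hy]
        simp
      have h3 := (h1.congr_of_eventuallyEq h2).deriv
      rw [iteratedDeriv_succ, h3]
      simp; ring
  have hev : ∀ᶠ x in 𝓝[>] (0:ℝ), x ∈ Ioo (0:ℝ) 1 := Ioo_mem_nhdsGT zero_lt_one
  have hle : 𝓝[>] (0:ℝ) ≤ 𝓝[Icc 0 1] 0 := by
    rw [← nhdsWithin_Ioo_eq_nhdsGT (zero_lt_one' ℝ)]
    exact nhdsWithin_mono _ Ioo_subset_Icc_self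
  have hult : ∀ n ≤ s, Tendsto (iteratedDeriv n u) (𝓝[>] 0)
      (𝓝 (iteratedDerivWithin n u (Icc 0 1) 0)) := by
    intro n hn
    have h1 := ((huc n hn) 0 (by simp)).mono_left hle
    refine h1.congr' ?_
    filter_upwards [hev] with x hx using hueq n hn x hx
  have hlim : ∀ n < s, Tendsto (fun x => x ^ (n + 1) * iteratedDeriv n v x) (𝓝[>] 0) (𝓝 0) := by
    intro n
    induction n with
    | zero =>
      intro hn
      have h1 := hult 0 (Nat.zero_le _)
      rw [iteratedDerivWithin_zero, iteratedDeriv_zero, h0] at h1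
      refine h1.congr' ?_
      filter_upwards [hev] with x hx
      have := hx.1.ne'
      simp [hv]; field_simp
    | succ n ih =>
      intro hn
      have hx0 : Tendsto (fun x : ℝ => x ^ (n + 1)) (𝓝[>] 0) (𝓝 0) := by
        have : Tendsto (fun x : ℝ => x ^ (n + 1)) (𝓝 0) (𝓝 (0 ^ (n + 1))) :=
          (continuous_pow (n + 1)).tendsto 0
        rw [zero_pow (Nat.succ_ne_zero n)] at this
        exact this.mono_left nhdsWithin_le_nhds
      have h1 := (hx0.mul (hult (n + 1) hn.le)).sub
        ((ih (Nat.lt_of_succ_lt hn)).const_mul ((n:ℝ) + 1))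
      simp only [zero_mul, mul_zero, sub_zero] at h1
      refine h1.congr' ?_
      filter_upwards [hev] with x hx
      rw [hrec n (Nat.lt_of_succ_lt hn) x hx]
      ring
  obtain ⟨M, hM⟩ := isCompact_Icc.exists_bound_of_continuousOn (huc (i + 1) hi)
  refine hardy_aux i (iteratedDeriv i v) (iteratedDeriv (i + 1) v) (iteratedDeriv (i + 1) u) M
    (fun x hx => hasDerivAt_iter (hva x hx) hi) (hrec i hi) ?_ ?_ (hlim i hi)
  · exact ((huc (i + 1) hi).mono Ioo_subset_Icc_self).congr fun x hx => (hueq _ hi x hx).symm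
  · intro x hx
    rw [← hueq _ hi x hx]
    exact hM x (Ioo_subset_Icc_self hx)

theorem refl_int (f : ℝ → ℝ) :
    ∫ x in Ioo (0:ℝ) 1, f (1 - x) = ∫ x in Ioo (0:ℝ) 1, f x := by
  rw [← integral_Ioc_eq_integral_Ioo, ← integral_Ioc_eq_integral_Ioo,
    ← intervalIntegral.integral_of_le zero_le_one, ← intervalIntegral.integral_of_le zero_le_one,
    intervalIntegral.integral_comp_sub_left]
  simp

theorem refl_integrable (f : ℝ → ℝ) (h : IntegrableOn (fun x => f (1 - x)) (Ioo (0:ℝ) 1)) :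
    IntegrableOn f (Ioo (0:ℝ) 1) := by
  rw [← intervalIntegrable_iff_integrableOn_Ioo_of_le zero_le_one] at h ⊢
  have := h.comp_sub_left 1
  simp only [sub_sub_cancel, sub_zero, sub_self] at this
  exact this.symm

theorem hardy_right (s : ℕ) (u : ℝ → ℝ) (hu : ContDiffOn ℝ s u (Icc (0:ℝ) 1)) (h1 : u 1 = 0)
    (i : ℕ) (hi : i < s) :
    IntegrableOn (fun x => iteratedDeriv i (fun y => u y / (1 - y)) x ^ 2) (Ioo 0 1) ∧
    ∫ x in Ioo (0:ℝ) 1, iteratedDeriv i (fun y => u y / (1 - y)) x ^ 2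
      ≤ 4 * ∫ x in Ioo (0:ℝ) 1, iteratedDeriv (i + 1) u x ^ 2 := by
  have hr : ContDiffOn ℝ s (fun x => u (1 - x)) (Icc (0:ℝ) 1) := by
    refine hu.comp (t := Icc (0:ℝ) 1) (by fun_prop) ?_
    intro x hx
    constructor <;> linarith [hx.1, hx.2]
  obtain ⟨a, -, c⟩ := hardy_left s (fun x => u (1 - x)) hr (by simpa using h1) i hi
  have e1 : ∀ x, iteratedDeriv i (fun y => u (1 - y) / y) x ^ 2 =
      (fun x => iteratedDeriv i (fun y => u y / (1 - y)) x ^ 2) (1 - x) := by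
    intro x
    have := congrFun (iteratedDeriv_comp_const_sub (n := i) (s := (1:ℝ))
      (f := fun y => u y / (1 - y))) x
    simp only [sub_sub_cancel] at this
    rw [this, smul_eq_mul, mul_pow, ← pow_mul, mul_comm i 2, pow_mul]
    simp
  have e2 : ∀ x, iteratedDeriv (i + 1) (fun y => u (1 - y)) x ^ 2 =
      (fun x => iteratedDeriv (i + 1) u x ^ 2) (1 - x) := by
    intro x
    have := congrFun (iteratedDeriv_comp_const_sub (n := i + 1) (s := (1:ℝ)) (f := u)) x
    rw [this, smul_eq_mul, mul_pow, ← pow_mul, mul_comm (i + 1) 2, pow_mul]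
    simp
  simp_rw [e1] at a c
  simp_rw [e2] at c
  rw [refl_int (fun x => iteratedDeriv i (fun y => u y / (1 - y)) x ^ 2),
    refl_int (fun x => iteratedDeriv (i + 1) u x ^ 2)] at c
  exact ⟨refl_integrable _ a, c⟩

/-- One-dimensional higher-order Hardy-type inequality on `(0,1)` with weight
`d(x) = x(1-x)`. -/
theorem one_dim_hardy (s : ℕ) (hs : 1 ≤ s) :
    ∃ C > 0, ∀ u : ℝ → ℝ,
      ContDiffOn ℝ (s : ℕ∞) u (Icc (0:ℝ) 1) → u 0 = 0 → u 1 = 0 →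
      (∑ i ∈ Finset.range s,
          ∫ x in Ioo (0:ℝ) 1,
            (iteratedDerivWithin i (fun y => u y / (y * (1 - y))) (Ioo (0:ℝ) 1) x)^2)
        ≤ C * ∑ i ∈ Finset.range (s+1),
            ∫ x in Ioo (0:ℝ) 1, (iteratedDerivWithin i u (Ioo (0:ℝ) 1) x)^2 := by
  refine ⟨16, by norm_num, fun u hu' h0 h1 => ?_⟩
  have hu : ContDiffOn ℝ s u (Icc (0:ℝ) 1) := by exact_mod_cast hu'
  have hua : ∀ x ∈ Ioo (0:ℝ) 1, ContDiffAt ℝ s u x := fun x hx =>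
    hu.contDiffAt (Icc_mem_nhds hx.1 hx.2)
  have hk : ∀ i ∈ Finset.range s, ∫ x in Ioo (0:ℝ) 1,
      (iteratedDerivWithin i (fun y => u y / (y * (1 - y))) (Ioo (0:ℝ) 1) x)^2 ≤
      16 * ∫ x in Ioo (0:ℝ) 1, (iteratedDerivWithin (i + 1) u (Ioo (0:ℝ) 1) x)^2 := by
    intro i hi
    have hi := Finset.mem_range.1 hi
    obtain ⟨a, -, b⟩ := hardy_left s u hu h0 i hi
    obtain ⟨c, d⟩ := hardy_right s u hu h1 i hi
    have hL : ∀ x ∈ Ioo (0:ℝ) 1,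
        iteratedDerivWithin i (fun y => u y / (y * (1 - y))) (Ioo (0:ℝ) 1) x =
        iteratedDeriv i (fun y => u y / y) x + iteratedDeriv i (fun y => u y / (1 - y)) x := by
      intro x hx
      have hle : ((i : ℕ) : WithTop ℕ∞) ≤ s := by exact_mod_cast hi.le
      have hx1 : 1 - x ≠ 0 := (sub_pos.2 hx.2).ne'
      have k1 : ContDiffAt ℝ i (fun y => u y / y) x :=
        ((hua x hx).of_le hle).div contDiffAt_id hx.1.ne'
      have k2 : ContDiffAt ℝ i (fun y => u y / (1 - y)) x :=
        ((hua x hx).of_le hle).div (by fun_prop) hx1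
      rw [iteratedDerivWithin_of_isOpen isOpen_Ioo hx, ← iteratedDeriv_fun_add k1 k2]
      apply Filter.EventuallyEq.iteratedDeriv_eq
      filter_upwards [Ioo_mem_nhds hx.1 hx.2] with y hy
      have y0 := hy.1.ne'
      have y1 : 1 - y ≠ 0 := (sub_pos.2 hy.2).ne'
      field_simp
      ring
    have hR : ∫ x in Ioo (0:ℝ) 1, (iteratedDerivWithin (i + 1) u (Ioo (0:ℝ) 1) x)^2 =
        ∫ x in Ioo (0:ℝ) 1, iteratedDeriv (i + 1) u x ^ 2 :=
      setIntegral_congr_fun measurableSet_Ioo fun x hx => by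
        simp only [iteratedDerivWithin_of_isOpen isOpen_Ioo hx]
    rw [hR]
    have hmono : ∫ x in Ioo (0:ℝ) 1,
        (iteratedDerivWithin i (fun y => u y / (y * (1 - y))) (Ioo (0:ℝ) 1) x)^2 ≤
        ∫ x in Ioo (0:ℝ) 1, (2 * iteratedDeriv i (fun y => u y / y) x ^ 2 +
          2 * iteratedDeriv i (fun y => u y / (1 - y)) x ^ 2) := by
      refine integral_mono_of_nonneg (Filter.Eventually.of_forall fun x => sq_nonneg _)
        ((a.const_mul 2).add (c.const_mul 2)) ?_
      refine (ae_restrict_iff' measurableSet_Ioo).2 (Filter.Eventually.of_forall fun x hx => ?_)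
      simp only [hL x hx]
      nlinarith [sq_nonneg (iteratedDeriv i (fun y => u y / y) x -
        iteratedDeriv i (fun y => u y / (1 - y)) x)]
    rw [integral_add (a.const_mul 2) (c.const_mul 2), integral_const_mul, integral_const_mul] at hmono
    linarith
  refine (Finset.sum_le_sum hk).trans ?_
  rw [← Finset.mul_sum, Finset.sum_range_succ']
  have : 0 ≤ ∫ x in Ioo (0:ℝ) 1, (iteratedDerivWithin 0 u (Ioo (0:ℝ) 1) x)^2 :=
    integral_nonneg fun x => sq_nonneg _
  linarith
end
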